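/- Positional reverse entropy power inequality for log-concave measures: there exists a universal constant C > 0 such that for every dimension d and every pair of independent random vectors X and Y in ℝ^d with log-concave densities, there exist linear maps u_1, u_2: ℝ^d → ℝ^d with determinant 1 such that N(u_1(X) + u_2(Y)) ≤ C·(N(X) + N(Y)). -/

import Mathlib

open MeasureTheory ProbabilityTheory Real
open scoped ENNReal

noncomputable section

/-- The random vector `X` has density `f` with respect to Lebesgue measure on `ℝ^d`. -/
def HasDensityFn {Ω : Type*} [MeasurableSpace Ω] {d : ℕ}
    (P : Measure Ω) (X : Ω → (Fin d → ℝ)) (f : (Fin d → ℝ) → ℝ) : Prop :=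
  Measurable X ∧ Measurable f ∧ (∀ x, 0 ≤ f x) ∧
    Measure.map X P = volume.withDensity (fun x => ENNReal.ofReal (f x))

/-- Shannon (differential) entropy of a density `f` on `ℝ^d`: `h(f) = -∫ f log f`. -/
def shannonEntropy (d : ℕ) (f : (Fin d → ℝ) → ℝ) : ℝ :=
  -∫ x, f x * Real.log (f x)

/-- Entropy power `N(f) = exp(2 h(f) / d)`. -/
def entropyPower (d : ℕ) (f : (Fin d → ℝ) → ℝ) : ℝ :=
  Real.exp (2 * shannonEntropy d f / d)

/-- A nonnegative function on a real vector space is log-concave: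
`f(αx + (1-α)y) ≥ f(x)^α f(y)^(1-α)`. -/
def IsLogConcaveFn {E : Type*} [AddCommGroup E] [Module ℝ E] (f : E → ℝ) : Prop :=
  (∀ x, 0 ≤ f x) ∧ ∀ x y : E, ∀ α : ℝ, 0 ≤ α → α ≤ 1 →
    f x ^ α * f y ^ (1 - α) ≤ f (α • x + (1 - α) • y)

namespace REPI

/-! ### Coverings -/

/-- `A` is covered by at most `M` translates of `S`. -/
def Cov {n : ℕ} (A S : Set (Fin n → ℝ)) (M : ℝ) : Prop :=
  ∃ c : Finset (Fin n → ℝ), (c.card : ℝ) ≤ M ∧ ∀ a ∈ A, ∃ x ∈ c, a - x ∈ S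

/-- Unit ball of `p`, scaled. -/
def Ks {n : ℕ} (p : Seminorm ℝ (Fin n → ℝ)) (t : ℝ) : Set (Fin n → ℝ) := {x | p x ≤ t}

/-- Polar body of `p`, scaled. -/
def Qs {n : ℕ} (p : Seminorm ℝ (Fin n → ℝ)) (t : ℝ) : Set (Fin n → ℝ) :=
  {x | ∀ y, x ⬝ᵥ y ≤ t * p y}

/-- Euclidean ball. -/
def Bs (n : ℕ) (t : ℝ) : Set (Fin n → ℝ) := {x | x ⬝ᵥ x ≤ t ^ 2}

lemma Cov.mono_card {n : ℕ} {A S : Set (Fin n → ℝ)} {M M' : ℝ} (h : Cov A S M) (hM : M ≤ M') :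
    Cov A S M' := by
  obtain ⟨c, hc, h⟩ := h
  exact ⟨c, hc.trans hM, h⟩

lemma Cov.trans {n : ℕ} {A S U : Set (Fin n → ℝ)} {M M' : ℝ} (h : Cov A S M) (h' : Cov S U M') :
    Cov A U (M * M') := by
  classical
  obtain ⟨c, hc, h⟩ := h
  obtain ⟨c', hc', h'⟩ := h'
  refine ⟨(c ×ˢ c').image (fun z => z.1 + z.2), ?_, ?_⟩
  · have h1 : (((c ×ˢ c').image (fun z => z.1 + z.2)).card : ℝ) ≤ (c.card : ℝ) * c'.card := by
      have := Finset.card_image_le (s := c ×ˢ c') (f := fun z => z.1 + z.2)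
      rw [Finset.card_product] at this
      exact_mod_cast this
    refine h1.trans ?_
    have : (0 : ℝ) ≤ c'.card := by positivity
    have : (0 : ℝ) ≤ c.card := by positivity
    nlinarith
  · intro a ha
    obtain ⟨x, hx, hax⟩ := h a ha
    obtain ⟨y, hy, hy'⟩ := h' _ hax
    refine ⟨x + y, Finset.mem_image.2 ⟨(x, y), by simp [hx, hy], rfl⟩, ?_⟩
    rwa [← sub_sub]

lemma Cov.image_smul {n : ℕ} {A S A' S' : Set (Fin n → ℝ)} {M : ℝ} (h : Cov A S M) {r : ℝ}
    (hr : r ≠ 0) (hA : ∀ a ∈ A', r⁻¹ • a ∈ A) (hS : ∀ s ∈ S, r • s ∈ S') : Cov A' S' M := by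
  classical
  obtain ⟨c, hc, h⟩ := h
  refine ⟨c.image (fun z => r • z), ?_, ?_⟩
  · refine le_trans ?_ hc
    exact_mod_cast Finset.card_image_le
  · intro a ha
    obtain ⟨x, hx, hax⟩ := h _ (hA a ha)
    refine ⟨r • x, Finset.mem_image.2 ⟨x, hx, rfl⟩, ?_⟩
    have := hS _ hax
    rwa [smul_sub, smul_inv_smul₀ hr] at this

lemma smul_mem_Ks {n : ℕ} (p : Seminorm ℝ (Fin n → ℝ)) {r t : ℝ} (hr : 0 ≤ r) {x : Fin n → ℝ}
    (hx : x ∈ Ks p t) : r • x ∈ Ks p (r * t) := by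
  simp only [Ks, Set.mem_ofPred_eq, map_smul_eq_mul, Real.norm_eq_abs, abs_of_nonneg hr] at *
  gcongr

lemma smul_mem_Qs {n : ℕ} (p : Seminorm ℝ (Fin n → ℝ)) {r t : ℝ} (hr : 0 ≤ r) {x : Fin n → ℝ}
    (hx : x ∈ Qs p t) : r • x ∈ Qs p (r * t) := by
  intro y
  rw [smul_dotProduct, smul_eq_mul, mul_assoc]
  exact mul_le_mul_of_nonneg_left (hx y) hr

lemma smul_mem_Bs {n : ℕ} {r t : ℝ} {x : Fin n → ℝ}
    (hx : x ∈ Bs n t) : r • x ∈ Bs n (r * t) := by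
  simp only [Bs, Set.mem_ofPred_eq, smul_dotProduct, dotProduct_smul, smul_eq_mul] at *
  nlinarith [sq_nonneg r, mul_le_mul_of_nonneg_left hx (sq_nonneg r)]

lemma seminorm_le {n : ℕ} (p : Seminorm ℝ (Fin n → ℝ)) : ∃ C : ℝ, 0 < C ∧ ∀ x, p x ≤ C * ‖x‖ := by
  refine ⟨1 + ∑ i, p (Pi.single i 1), ?_, ?_⟩
  · have : 0 ≤ ∑ i, p (Pi.single i 1) := Finset.sum_nonneg fun i _ => apply_nonneg _ _
    linarith
  · intro x
    have h0 : x = ∑ i, x i • (Pi.single i (1 : ℝ) : Fin n → ℝ) := by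
      ext j
      simp [Finset.sum_apply, Pi.single_apply]
    calc p x = p (∑ i, x i • (Pi.single i (1 : ℝ) : Fin n → ℝ)) := by rw [← h0]
      _ ≤ ∑ i, p (x i • (Pi.single i (1 : ℝ) : Fin n → ℝ)) := by
          exact Finset.le_sum_of_subadditive p (map_zero p).le (map_add_le_add p) _ _
      _ ≤ ∑ i, ‖x‖ * p (Pi.single i 1) := by
          refine Finset.sum_le_sum fun i _ => ?_
          rw [map_smul_eq_mul]
          exact mul_le_mul_of_nonneg_right (norm_le_pi_norm x i) (apply_nonneg _ _)
      _ ≤ _ := by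
          rw [← Finset.mul_sum]
          nlinarith [norm_nonneg x]

lemma seminorm_cont {n : ℕ} (p : Seminorm ℝ (Fin n → ℝ)) : Continuous p := by
  obtain ⟨C, hC, h⟩ := seminorm_le p
  refine (LipschitzWith.of_dist_le_mul (K := ⟨C, hC.le⟩) ?_).continuous
  intro x y
  rw [Real.dist_eq, dist_eq_norm]
  exact (abs_sub_map_le_sub p x y).trans (h _)

lemma dot_nonneg {n : ℕ} (x : Fin n → ℝ) : 0 ≤ x ⬝ᵥ x :=
  Finset.sum_nonneg fun _ _ => mul_self_nonneg _

lemma sub_dot_self {n : ℕ} (x y : Fin n → ℝ) :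
    (x - y) ⬝ᵥ (x - y) = x ⬝ᵥ x - 2 * (x ⬝ᵥ y) + y ⬝ᵥ y := by
  rw [sub_dotProduct, dotProduct_sub, dotProduct_sub, dotProduct_comm y x]; ring

lemma add_dot_self {n : ℕ} (x y : Fin n → ℝ) :
    (x + y) ⬝ᵥ (x + y) = x ⬝ᵥ x + 2 * (x ⬝ᵥ y) + y ⬝ᵥ y := by
  rw [add_dotProduct, dotProduct_add, dotProduct_add, dotProduct_comm y x]; ring

/-- The Euclidean ball lies in `K/(2s) + s K°`. -/
lemma decomp {n : ℕ} (p : Seminorm ℝ (Fin n → ℝ)) {c : ℝ} (hc : 0 < c)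
    (hp : ∀ x, c * ‖x‖ ≤ p x) {s : ℝ} (hs : 0 < s) {x : Fin n → ℝ} (hx : x ∈ Bs n 1) :
    ∃ y ∈ Ks p (1 / (2 * s)), x - y ∈ Qs p s := by
  have hcont : Continuous fun y : Fin n → ℝ => (x - y) ⬝ᵥ (x - y) / 2 + s * p y := by
    have := seminorm_cont p
    fun_prop
  have hlim : Filter.Tendsto (fun y : Fin n → ℝ => (x - y) ⬝ᵥ (x - y) / 2 + s * p y)
      (Filter.cocompact _) Filter.atTop := by
    refine Filter.tendsto_atTop_mono (f := fun y => (s * c) * ‖y‖) ?_ ?_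
    · intro y
      have := dot_nonneg (x - y)
      have := mul_le_mul_of_nonneg_left (hp y) hs.le
      linarith
    · exact (tendsto_norm_cocompact_atTop).const_mul_atTop (by positivity)
  obtain ⟨y, hy⟩ := hcont.exists_forall_le hlim
  have hx1 : x ⬝ᵥ x ≤ 1 := by simpa [Bs] using hx
  refine ⟨y, ?_, ?_⟩
  · have h0 := hy 0
    simp only [sub_zero, map_zero, mul_zero, add_zero] at h0
    have := dot_nonneg (x - y)
    simp only [Ks, Set.mem_ofPred_eq]
    rw [le_div_iff₀ (by positivity)]
    nlinarith
  · intro u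
    have key : ∀ ε : ℝ, 0 < ε → (x - y) ⬝ᵥ u ≤ s * p u + ε * (u ⬝ᵥ u / 2) := by
      intro ε hε
      have h1 := hy (y + ε • u)
      have h2 : p (y + ε • u) ≤ p y + ε * p u := by
        refine (map_add_le_add p _ _).trans ?_
        rw [map_smul_eq_mul, Real.norm_eq_abs, abs_of_pos hε]
      have h3 : x - (y + ε • u) = (x - y) - ε • u := by abel
      rw [h3, sub_dot_self (x - y) (ε • u)] at h1
      simp only [dotProduct_smul, smul_dotProduct, smul_eq_mul] at h1
      have h4 := mul_le_mul_of_nonneg_left h2 hs.le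
      have h5 : ε * ((x - y) ⬝ᵥ u) ≤ ε * (s * p u + ε * (u ⬝ᵥ u / 2)) := by nlinarith
      exact le_of_mul_le_mul_left h5 hε
    have hu := dot_nonneg u
    refine le_of_forall_pos_le_add fun δ hδ => ?_
    refine (key (δ / (u ⬝ᵥ u / 2 + 1)) (by positivity)).trans ?_
    gcongr
    rw [div_mul_eq_mul_div, div_le_iff₀ (by positivity)]
    nlinarith

/-- Separated subsets of `K` are small. -/
lemma packing {n : ℕ} (p : Seminorm ℝ (Fin n → ℝ)) (ν : Measure (Fin n → ℝ))
    [IsProbabilityMeasure ν]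
    (hν : ∀ (y : Fin n → ℝ) (S : Set (Fin n → ℝ)), MeasurableSet S →
      ENNReal.ofReal (exp (-(3 / 2) * p y)) * ν S ≤ ν ((fun z => z - y) ⁻¹' S))
    (b : Fin n → ℝ) {R : ℝ} (hR : 0 < R) (hb : ENNReal.ofReal (3 / 4) ≤ ν {z | z - b ∈ Bs n R})
    {t : ℝ} (ht : 0 < t) (c : Finset (Fin n → ℝ)) (hcK : ∀ x ∈ c, p x ≤ 1)
    (hsep : ∀ x ∈ c, ∀ y ∈ c, x ≠ y → x - y ∉ Bs n t) :
    (c.card : ℝ) ≤ exp (6 * R / t) := by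
  set l := 2 * R / t with hl
  have hlpos : 0 < l := by positivity
  set S : Set (Fin n → ℝ) := {z | z - b ∈ Bs n R} with hS
  have hSm : MeasurableSet S := by
    have : IsClosed S := by
      simp only [hS, Bs, Set.mem_ofPred_eq]
      exact isClosed_le (by fun_prop) (by fun_prop)
    exact this.measurableSet
  have hdisj : (c : Set (Fin n → ℝ)).PairwiseDisjoint
      (fun x => (fun z => z - l • x) ⁻¹' S) := by
    intro x hx y hy hxy
    refine Set.disjoint_left.2 ?_
    intro z hz1 hz2
    apply hsep x hx y hy hxy
    simp only [hS, Bs, Set.mem_preimage, Set.mem_ofPred_eq] at hz1 hz2 ⊢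
    set u := z - l • x - b
    set v := z - l • y - b
    have h1 : v - u = l • (x - y) := by
      simp only [u, v, smul_sub]; abel
    have h2 : (v - u) ⬝ᵥ (v - u) + (v + u) ⬝ᵥ (v + u) = 2 * (v ⬝ᵥ v) + 2 * (u ⬝ᵥ u) := by
      rw [sub_dot_self, add_dot_self]; ring
    have h3 := dot_nonneg (v + u)
    rw [h1] at h2
    simp only [dotProduct_smul, smul_dotProduct, smul_eq_mul] at h2
    have h4 : l * (l * ((x - y) ⬝ᵥ (x - y))) ≤ l * (l * t ^ 2) := by
      have : l * (l * t ^ 2) = 4 * R ^ 2 := by rw [hl]; field_simp; norm_num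
      nlinarith
    exact le_of_mul_le_mul_left (le_of_mul_le_mul_left h4 hlpos) hlpos
  have hsum : ∑ x ∈ c, ν ((fun z => z - l • x) ⁻¹' S) ≤ 1 := by
    rw [← measure_biUnion_finset hdisj (fun x _ => hSm.preimage (by fun_prop))]
    exact prob_le_one
  have hlow : (c.card : ℝ≥0∞) * (ENNReal.ofReal (exp (-(3 / 2) * l)) * ENNReal.ofReal (3 / 4)) ≤ 1 := by
    refine le_trans ?_ hsum
    rw [← nsmul_eq_mul]
    refine Finset.card_nsmul_le_sum _ _ _ ?_
    intro x hx
    refine le_trans ?_ (hν (l • x) S hSm)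
    have hle : -(3 / 2) * l ≤ -(3 / 2) * p (l • x) := by
      rw [map_smul_eq_mul, Real.norm_eq_abs, abs_of_pos hlpos]
      nlinarith [hcK x hx]
    exact mul_le_mul' (ENNReal.ofReal_le_ofReal (exp_le_exp.2 hle)) hb
  have hreal : (c.card : ℝ) * (exp (-(3 / 2) * l) * (3 / 4)) ≤ 1 := by
    rw [← ENNReal.ofReal_mul (exp_pos _).le, ← ENNReal.ofReal_natCast, ← ENNReal.ofReal_mul (by positivity),
      ENNReal.ofReal_le_one] at hlow
    exact hlow
  have h6 : 6 * R / t = 3 / 2 * l + 3 / 2 * l := by rw [hl]; ring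
  rw [h6, exp_add]
  have hinv : exp (-(3 / 2) * l) * exp (3 / 2 * l) = 1 := by rw [← exp_add]; simp
  have hone : 1 ≤ exp (3 / 2 * l) := one_le_exp (by positivity)
  set e := exp (3 / 2 * l)
  have h7 : (c.card : ℝ) * (3 / 4) ≤ e := by
    have := mul_le_mul_of_nonneg_right hreal (by positivity : 0 ≤ e)
    calc (c.card : ℝ) * (3 / 4) = (c.card : ℝ) * (3 / 4) * (exp (-(3 / 2) * l) * e) := by rw [hinv]; ring
      _ ≤ _ := by linarith
  rcases Nat.lt_or_ge c.card 2 with h | h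
  · have : (c.card : ℝ) ≤ 1 := by exact_mod_cast Nat.lt_succ_iff.1 h
    nlinarith
  · have : (2 : ℝ) ≤ c.card := by exact_mod_cast h
    nlinarith

lemma cov_K {n : ℕ} (p : Seminorm ℝ (Fin n → ℝ)) (ν : Measure (Fin n → ℝ))
    [IsProbabilityMeasure ν]
    (hν : ∀ (y : Fin n → ℝ) (S : Set (Fin n → ℝ)), MeasurableSet S →
      ENNReal.ofReal (exp (-(3 / 2) * p y)) * ν S ≤ ν ((fun z => z - y) ⁻¹' S))
    (b : Fin n → ℝ) {R : ℝ} (hR : 0 < R) (hb : ENNReal.ofReal (3 / 4) ≤ ν {z | z - b ∈ Bs n R})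
    {t : ℝ} (ht : 0 < t) : Cov (Ks p 1) (Bs n t) (exp (6 * R / t)) := by
  classical
  let P : ℕ → Prop := fun k => ∃ c : Finset (Fin n → ℝ), c.card = k ∧ (∀ x ∈ c, p x ≤ 1) ∧
    (∀ x ∈ c, ∀ y ∈ c, x ≠ y → x - y ∉ Bs n t)
  have hP0 : P 0 := ⟨∅, by simp⟩
  have hbd : ∀ k, P k → k ≤ ⌊exp (6 * R / t)⌋₊ := by
    rintro k ⟨c, rfl, h1, h2⟩
    exact Nat.le_floor (packing p ν hν b hR hb ht c h1 h2)
  have hmax := Nat.findGreatest_spec (P := P) (Nat.zero_le ⌊exp (6 * R / t)⌋₊) hP0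
  have hgt := fun k => Nat.findGreatest_is_greatest (P := P) (n := ⌊exp (6 * R / t)⌋₊) (k := k)
  set m := Nat.findGreatest P ⌊exp (6 * R / t)⌋₊
  obtain ⟨c, hc, h1, h2⟩ := hmax
  refine ⟨c, packing p ν hν b hR hb ht c h1 h2, ?_⟩
  intro a ha
  by_contra! hcon
  have hac : a ∉ c := by
    intro h
    apply hcon a h
    simp [Bs]; positivity
  have hsymm : ∀ x : Fin n → ℝ, x - a ∈ Bs n t → a - x ∈ Bs n t := by
    intro x hx
    have : a - x = -(x - a) := by abel
    simp only [Bs, Set.mem_ofPred_eq] at *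
    rw [this, neg_dotProduct, dotProduct_neg, neg_neg]; exact hx
  have hPm : P (m + 1) := by
    refine ⟨insert a c, by rw [Finset.card_insert_of_notMem hac, hc], ?_, ?_⟩
    · intro x hx
      rcases Finset.mem_insert.1 hx with rfl | hx
      · exact ha
      · exact h1 x hx
    · intro x hx y hy hxy
      rcases Finset.mem_insert.1 hx with hx' | hx'
      · rcases Finset.mem_insert.1 hy with hy' | hy'
        · exact absurd (hx'.trans hy'.symm) hxy
        · rw [hx']; exact hcon y hy'
      · rcases Finset.mem_insert.1 hy with hy' | hy'
        · rw [hy']; exact fun h => hcon x hx' (hsymm x h)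
        · exact h2 x hx' y hy' hxy
  exact hgt (m + 1) (Nat.lt_succ_self m) (hbd _ hPm) hPm

/-- Duality of covering numbers. -/
lemma cov_dual {n : ℕ} (p : Seminorm ℝ (Fin n → ℝ)) {c : ℝ} (hc : 0 < c)
    (hp : ∀ x, c * ‖x‖ ≤ p x) {R : ℝ} (hR : 0 < R)
    (hcov : ∀ t : ℝ, 0 < t → Cov (Ks p 1) (Bs n t) (exp (6 * R / t)))
    {t : ℝ} (ht : 0 < t) : Cov (Bs n 1) (Qs p t) (exp (72 * R / t)) := by
  have step : ∀ t : ℝ, 0 < t → Cov (Bs n 1) (Qs p (4 / 3 * t)) (exp (72 * R / (4 / 3 * t))) →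
      Cov (Bs n 1) (Qs p t) (exp (72 * R / t)) := by
    intro t ht h
    set s := t / 3 with hs
    have hspos : 0 < s := by positivity
    have h1 : Cov (Ks p (1 / (2 * s))) (Bs n (1 / 2)) (exp (6 * R / s)) := by
      refine (hcov s hspos).image_smul (r := 1 / (2 * s)) (by positivity) ?_ ?_
      · intro a ha
        have := smul_mem_Ks p (r := (1 / (2 * s))⁻¹) (by positivity) ha
        rwa [inv_mul_cancel₀ (by positivity)] at this
      · intro x hx
        have := smul_mem_Bs (r := 1 / (2 * s)) hx
        have e : 1 / (2 * s) * s = 1 / 2 := by field_simp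
        rwa [e] at this
    have h2 : Cov (Bs n (1 / 2)) (Qs p (2 * s)) (exp (72 * R / (4 / 3 * t))) := by
      refine h.image_smul (r := 1 / 2) (by positivity) ?_ ?_
      · intro a ha
        have := smul_mem_Bs (r := (1 / 2 : ℝ)⁻¹) ha
        rwa [inv_mul_cancel₀ (by positivity)] at this
      · intro x hx
        have := smul_mem_Qs p (r := 1 / 2) (by positivity) hx
        have e : 1 / 2 * (4 / 3 * t) = 2 * s := by rw [hs]; ring
        rwa [e] at this
    obtain ⟨d, hd, hd'⟩ := h1.trans h2
    refine ⟨d, hd.trans (le_of_eq ?_), ?_⟩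
    · rw [← exp_add]
      congr 1
      rw [hs]; field_simp; norm_num
    · intro a ha
      obtain ⟨y, hy, hay⟩ := decomp p hc hp hspos ha
      obtain ⟨x, hx, hyx⟩ := hd' y hy
      refine ⟨x, hx, fun u => ?_⟩
      have e : a - x = (a - y) + (y - x) := by abel
      rw [e, add_dotProduct]
      have := hay u
      have := hyx u
      have e2 : t * p u = s * p u + 2 * s * p u := by rw [hs]; ring
      linarith
  -- base
  have base : ∃ T : ℝ, 0 < T ∧ ∀ t, T ≤ t → Cov (Bs n 1) (Qs p t) (exp (72 * R / t)) := by
    refine ⟨n / c + 1, by positivity, fun t hT => ?_⟩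
    have htpos : 0 < t := lt_of_lt_of_le (by positivity) hT
    refine ⟨{0}, by simpa using one_le_exp (by positivity), fun a ha => ⟨0, by simp, ?_⟩⟩
    rw [sub_zero]
    intro y
    have ha1 : a ⬝ᵥ a ≤ 1 := by simpa [Bs] using ha
    have hai : ∀ i, |a i| ≤ 1 := by
      intro i
      have : a i * a i ≤ a ⬝ᵥ a :=
        Finset.single_le_sum (f := fun i => a i * a i) (fun i _ => mul_self_nonneg _) (Finset.mem_univ i)
      exact abs_le_one_iff_mul_self_le_one.2 (this.trans ha1)
    have h1 : a ⬝ᵥ y ≤ n * ‖y‖ := by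
      calc a ⬝ᵥ y ≤ ∑ _i : Fin n, ‖y‖ := by
            refine Finset.sum_le_sum fun i _ => ?_
            have h3 : |y i| ≤ ‖y‖ := norm_le_pi_norm y i
            calc a i * y i ≤ |a i * y i| := le_abs_self _
              _ = |a i| * |y i| := abs_mul _ _
              _ ≤ 1 * ‖y‖ := mul_le_mul (hai i) h3 (abs_nonneg _) zero_le_one
              _ = ‖y‖ := one_mul _
        _ = n * ‖y‖ := by simp
    have h2 : n * ‖y‖ = n / c * (c * ‖y‖) := by field_simp
    have h3 : (n : ℝ) / c * (c * ‖y‖) ≤ t * p y := by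
      have : (n : ℝ) / c ≤ t := by linarith
      exact mul_le_mul this (hp y) (by positivity) htpos.le
    linarith
  obtain ⟨T, hT, hbase⟩ := base
  have ind : ∀ k : ℕ, ∀ t : ℝ, 0 < t → T ≤ (4 / 3) ^ k * t → Cov (Bs n 1) (Qs p t) (exp (72 * R / t)) := by
    intro k
    induction k with
    | zero => intro t _ h; exact hbase t (by simpa using h)
    | succ k ih =>
      intro t ht h
      refine step t ht (ih _ (by positivity) ?_)
      rw [pow_succ] at h
      linarith
  obtain ⟨k, hk⟩ := pow_unbounded_of_one_lt (T / t) (by norm_num : (1 : ℝ) < 4 / 3)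
  refine ind k t ht ?_
  rw [div_lt_iff₀ ht] at hk
  exact hk.le

/-- Volume bound from a covering. -/
lemma Cov.volume_le {n : ℕ} {A S : Set (Fin n → ℝ)} {M : ℝ} (h : Cov A S M) :
    volume A ≤ ENNReal.ofReal M * volume S := by
  obtain ⟨c, hc, h⟩ := h
  calc volume A ≤ volume (⋃ x ∈ c, (fun z => z - x) ⁻¹' S) := by
        refine measure_mono fun a ha => ?_
        obtain ⟨x, hx, hax⟩ := h a ha
        simp only [Set.mem_iUnion]
        exact ⟨x, hx, hax⟩
    _ ≤ ∑ x ∈ c, volume ((fun z => z - x) ⁻¹' S) := measure_biUnion_finset_le _ _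
    _ = c.card * volume S := by
        simp only [sub_eq_add_neg, measure_preimage_add_right]
        simp
    _ ≤ _ := by
        gcongr
        rw [← ENNReal.ofReal_natCast]
        exact ENNReal.ofReal_le_ofReal hc

end REPI

namespace REPI

/-! ### The exponential tilts -/

lemma integrable_pow_exp {n : ℕ} (k : ℕ) {a : ℝ} (ha : 0 < a) :
    Integrable (fun y : Fin n → ℝ => (1 + ‖y‖) ^ k * exp (-a * ‖y‖)) := by
  set m := k + n + 1 with hm
  have h1 : Integrable (fun y : Fin n → ℝ => (1 + ‖y‖) ^ (-((n : ℝ) + 1))) := by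
    apply integrable_one_add_norm
    simp
  refine (h1.const_mul (m.factorial / a ^ m * exp a)).mono' (by fun_prop) ?_
  refine Filter.Eventually.of_forall fun y => ?_
  have hu : 0 < 1 + ‖y‖ := by positivity
  have h2 := Real.pow_div_factorial_le_exp (a * (1 + ‖y‖)) (by positivity) m
  rw [Real.norm_of_nonneg (by positivity), Real.rpow_neg hu.le, ← div_eq_mul_inv,
    le_div_iff₀ (by positivity)]
  have e1 : (1 + ‖y‖) ^ ((n : ℝ) + 1) = (1 + ‖y‖) ^ (n + 1) := by
    rw [← Real.rpow_natCast]; push_cast; rfl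
  rw [e1]
  have e2 : (1 + ‖y‖) ^ k * exp (-a * ‖y‖) * (1 + ‖y‖) ^ (n + 1)
      = (1 + ‖y‖) ^ m * exp (-a * ‖y‖) := by rw [hm]; ring
  rw [e2]
  rw [div_le_iff₀ (by positivity), mul_pow] at h2
  have e3 : exp (a * (1 + ‖y‖)) = exp a * exp (a * ‖y‖) := by rw [← exp_add]; ring_nf
  have e4 : exp (a * ‖y‖) * exp (-a * ‖y‖) = 1 := by rw [← exp_add]; simp
  have h3 : (1 + ‖y‖) ^ m ≤ m.factorial / a ^ m * exp a * exp (a * ‖y‖) := by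
    rw [div_mul_eq_mul_div, div_mul_eq_mul_div, le_div_iff₀ (by positivity)]
    rw [e3] at h2
    linarith
  calc (1 + ‖y‖) ^ m * exp (-a * ‖y‖)
      ≤ (m.factorial / a ^ m * exp a * exp (a * ‖y‖)) * exp (-a * ‖y‖) := by gcongr
    _ = _ := by rw [mul_assoc, e4, mul_one]

lemma abs_dot_le {n : ℕ} (x y : Fin n → ℝ) : |x ⬝ᵥ y| ≤ n * ‖x‖ * ‖y‖ := by
  calc |x ⬝ᵥ y| ≤ ∑ i, |x i * y i| := Finset.abs_sum_le_sum_abs _ _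
    _ ≤ ∑ _i : Fin n, ‖x‖ * ‖y‖ := by
        refine Finset.sum_le_sum fun i _ => ?_
        rw [abs_mul]
        exact mul_le_mul (norm_le_pi_norm x i) (norm_le_pi_norm y i) (abs_nonneg _) (norm_nonneg _)
    _ = _ := by simp; ring

section
variable {n : ℕ} (p : Seminorm ℝ (Fin n → ℝ))

lemma w_le {x : Fin n → ℝ} (hx : x ∈ Qs p (3 / 4)) (y : Fin n → ℝ) :
    exp (x ⬝ᵥ y - p y) ≤ exp (-(1 / 4) * p y) := by
  apply exp_le_exp.2
  have := hx y
  linarith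

lemma w_integrable {c : ℝ} (hc : 0 < c) (hp : ∀ x, c * ‖x‖ ≤ p x) {F : Type*} [NormedAddCommGroup F] [NormedSpace ℝ F]
    {x : Fin n → ℝ} (hx : x ∈ Qs p (3 / 4)) {φ : (Fin n → ℝ) → F}
    (hφ : AEStronglyMeasurable φ) (A : ℝ) (k : ℕ) (hb : ∀ y, ‖φ y‖ ≤ A * (1 + ‖y‖) ^ k) :
    Integrable (fun y => exp (x ⬝ᵥ y - p y) • φ y) := by
  have hpc := seminorm_cont p
  refine ((integrable_pow_exp (n := n) k (a := c / 4) (by positivity)).const_mul A).mono'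
    (AEStronglyMeasurable.smul (by fun_prop) hφ) ?_
  refine Filter.Eventually.of_forall fun y => ?_
  rw [norm_smul, Real.norm_of_nonneg (exp_pos _).le]
  have h1 : exp (x ⬝ᵥ y - p y) ≤ exp (-(c / 4) * ‖y‖) := by
    refine (w_le p hx y).trans (exp_le_exp.2 ?_)
    have := hp y
    linarith
  calc exp (x ⬝ᵥ y - p y) * ‖φ y‖ ≤ exp (-(c / 4) * ‖y‖) * (A * (1 + ‖y‖) ^ k) :=
        mul_le_mul h1 (hb y) (norm_nonneg _) (exp_pos _).le
    _ = _ := by ring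

/-- dot product as a continuous linear functional -/
def Ld (y : Fin n → ℝ) : (Fin n → ℝ) →L[ℝ] ℝ := ∑ i, y i • ContinuousLinearMap.proj i

lemma Ld_apply (y v : Fin n → ℝ) : Ld y v = y ⬝ᵥ v := by
  simp [Ld, dotProduct, sum_apply]

lemma Ld_cont : Continuous (Ld : (Fin n → ℝ) → _) := by
  unfold Ld; fun_prop

lemma Ld_norm (y : Fin n → ℝ) : ‖Ld y‖ ≤ n * ‖y‖ := by
  refine ContinuousLinearMap.opNorm_le_bound _ (by positivity) fun v => ?_
  rw [Ld_apply, Real.norm_eq_abs]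
  exact abs_dot_le y v

lemma nhds_Qs {c : ℝ} (hc : 0 < c) (hp : ∀ x, c * ‖x‖ ≤ p x) {x : Fin n → ℝ} (hx : x ∈ Qs p (1 / 2)) : Qs p (3 / 4) ∈ nhds x := by
  refine Metric.mem_nhds_iff.2 ⟨c / (4 * (n + 1)), by positivity, fun z hz y => ?_⟩
  have h1 : z ⬝ᵥ y = x ⬝ᵥ y + (z - x) ⬝ᵥ y := by rw [sub_dotProduct]; ring
  have h2 := (le_abs_self _).trans (abs_dot_le (z - x) y)
  have h3 : ‖z - x‖ < c / (4 * (n + 1)) := by simpa [dist_eq_norm] using hz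
  have h4 : n * ‖z - x‖ ≤ c / 4 := by
    have : (n : ℝ) * ‖z - x‖ ≤ (n + 1) * (c / (4 * (n + 1))) := by gcongr; linarith
    have e : ((n : ℝ) + 1) * (c / (4 * (n + 1))) = c / 4 := by field_simp
    linarith
  have h5 : n * ‖z - x‖ * ‖y‖ ≤ c / 4 * ‖y‖ := by gcongr
  have := hx y
  have := hp y
  rw [h1]
  linarith

lemma w_hasFDerivAt {c : ℝ} (hc : 0 < c) (hp : ∀ x, c * ‖x‖ ≤ p x) {x : Fin n → ℝ} (hx : x ∈ Qs p (1 / 2)) {φ : (Fin n → ℝ) → ℝ}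
    (hφ : Continuous φ) (A : ℝ) (k : ℕ) (hb : ∀ y, |φ y| ≤ A * (1 + ‖y‖) ^ k) :
    HasFDerivAt (fun x => ∫ y, exp (x ⬝ᵥ y - p y) * φ y)
      (∫ y, exp (x ⬝ᵥ y - p y) • (φ y • Ld y)) x := by
  have hpc := seminorm_cont p
  have hLc := Ld_cont (n := n)
  have hnn := nhds_Qs p hc hp hx
  have hx' : x ∈ Qs p (3 / 4) := mem_of_mem_nhds hnn
  refine hasFDerivAt_integral_of_dominated_of_fderiv_le
    (F := fun x y => exp (x ⬝ᵥ y - p y) * φ y)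
    (F' := fun x y => exp (x ⬝ᵥ y - p y) • (φ y • Ld y)) (s := Qs p (3 / 4))
    (bound := fun y => A * n * ((1 + ‖y‖) ^ (k + 1) * exp (-(c / 4) * ‖y‖))) hnn ?_ ?_ ?_ ?_ ?_ ?_
  · exact Filter.Eventually.of_forall fun z => Continuous.aestronglyMeasurable (by fun_prop)
  · exact w_integrable p hc hp hx' hφ.aestronglyMeasurable A k hb
  · exact Continuous.aestronglyMeasurable (by fun_prop)
  · refine Filter.Eventually.of_forall fun y z hz => ?_
    rw [norm_smul, norm_smul, Real.norm_of_nonneg (exp_pos _).le, Real.norm_eq_abs]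
    have h1 : exp (z ⬝ᵥ y - p y) ≤ exp (-(c / 4) * ‖y‖) := by
      refine (w_le p hz y).trans (exp_le_exp.2 ?_)
      have := hp y
      linarith
    have h2 : ‖Ld y‖ ≤ n * (1 + ‖y‖) := (Ld_norm y).trans (by gcongr; linarith)
    have hA : 0 ≤ A * (1 + ‖y‖) ^ k := (abs_nonneg _).trans (hb y)
    calc exp (z ⬝ᵥ y - p y) * (|φ y| * ‖Ld y‖)
        ≤ exp (-(c / 4) * ‖y‖) * ((A * (1 + ‖y‖) ^ k) * (n * (1 + ‖y‖))) := by
          refine mul_le_mul h1 ?_ (by positivity) (exp_pos _).le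
          exact mul_le_mul (hb y) h2 (norm_nonneg _) hA
      _ = _ := by ring
  · exact (integrable_pow_exp (k + 1) (by positivity)).const_mul _
  · refine Filter.Eventually.of_forall fun y z _ => ?_
    have h1 : HasFDerivAt (fun z : Fin n → ℝ => z ⬝ᵥ y - p y) (Ld y) z := by
      have : (fun z : Fin n → ℝ => z ⬝ᵥ y - p y) = fun z => Ld y z - p y := by
        ext z; rw [Ld_apply, dotProduct_comm]
      rw [this]
      exact ((Ld y).hasFDerivAt).sub_const _
    have h2 := (h1.exp).mul_const (φ y)
    refine h2.congr_fderiv ?_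
    ext v
    simp
    ring

/-- tilted probability measure -/
def tl (x : Fin n → ℝ) : Measure (Fin n → ℝ) := volume.tilted (fun y => x ⬝ᵥ y - p y)

lemma w_int1 {c : ℝ} (hc : 0 < c) (hp : ∀ x, c * ‖x‖ ≤ p x) {x : Fin n → ℝ} (hx : x ∈ Qs p (3 / 4)) :
    Integrable (fun y => exp (x ⬝ᵥ y - p y)) := by
  have := w_integrable p hc hp hx (φ := fun _ => (1 : ℝ)) (by fun_prop) 1 0 (by simp)
  simpa using this

lemma tl_prob {c : ℝ} (hc : 0 < c) (hp : ∀ x, c * ‖x‖ ≤ p x) {x : Fin n → ℝ} (hx : x ∈ Qs p (3 / 4)) : IsProbabilityMeasure (tl p x) :=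
  isProbabilityMeasure_tilted (w_int1 p hc hp hx)

lemma tl_integrable {c : ℝ} (hc : 0 < c) (hp : ∀ x, c * ‖x‖ ≤ p x) {F : Type*} [NormedAddCommGroup F] [NormedSpace ℝ F]
    {x : Fin n → ℝ} (hx : x ∈ Qs p (3 / 4)) {φ : (Fin n → ℝ) → F}
    (hφ : AEStronglyMeasurable φ) (A : ℝ) (k : ℕ) (hb : ∀ y, ‖φ y‖ ≤ A * (1 + ‖y‖) ^ k) :
    Integrable φ (tl p x) := by
  have hpc := seminorm_cont p
  exact (integrable_tilted_iff (w_int1 p hc hp hx) _).2 (w_integrable p hc hp hx hφ A k hb)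

lemma tl_integral (x : Fin n → ℝ) (φ : (Fin n → ℝ) → ℝ) :
    ∫ y, φ y ∂(tl p x) = (∫ y, exp (x ⬝ᵥ y - p y) * φ y) / ∫ y, exp (x ⬝ᵥ y - p y) := by
  rw [tl, integral_tilted, ← integral_div]
  congr 1
  ext y
  rw [smul_eq_mul]; ring

lemma G_pos {c : ℝ} (hc : 0 < c) (hp : ∀ x, c * ‖x‖ ≤ p x) {x : Fin n → ℝ} (hx : x ∈ Qs p (3 / 4)) : 0 < ∫ y, exp (x ⬝ᵥ y - p y) :=
  integral_exp_pos (w_int1 p hc hp hx)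

/-- barycenter -/
def bar (x : Fin n → ℝ) : Fin n → ℝ := fun i => ∫ y, y i ∂(tl p x)

/-- covariance -/
def cov (x : Fin n → ℝ) : Matrix (Fin n) (Fin n) ℝ :=
  fun i j => ∫ y, (y i - bar p x i) * (y j - bar p x j) ∂(tl p x)

lemma abs_coord (y : Fin n → ℝ) (i : Fin n) : |y i| ≤ 1 + ‖y‖ := by
  have : |y i| ≤ ‖y‖ := norm_le_pi_norm y i
  linarith

lemma int_coord {c : ℝ} (hc : 0 < c) (hp : ∀ x, c * ‖x‖ ≤ p x) {x : Fin n → ℝ} (hx : x ∈ Qs p (3 / 4)) (i : Fin n) :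
    Integrable (fun y : Fin n → ℝ => y i) (tl p x) :=
  tl_integrable p hc hp hx (continuous_apply i).aestronglyMeasurable 1 1 (fun y => by
    rw [Real.norm_eq_abs, one_mul, pow_one]; exact abs_coord y i)

lemma int_coord2 {c : ℝ} (hc : 0 < c) (hp : ∀ x, c * ‖x‖ ≤ p x) {x : Fin n → ℝ} (hx : x ∈ Qs p (3 / 4)) (i j : Fin n) :
    Integrable (fun y : Fin n → ℝ => y i * y j) (tl p x) :=
  tl_integrable p hc hp hx (Continuous.aestronglyMeasurable (by fun_prop)) 1 2 (fun y => by
    rw [Real.norm_eq_abs, one_mul, abs_mul, sq]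
    exact mul_le_mul (abs_coord y i) (abs_coord y j) (abs_nonneg _) (by positivity))

lemma int_cov {c : ℝ} (hc : 0 < c) (hp : ∀ x, c * ‖x‖ ≤ p x) {x : Fin n → ℝ} (hx : x ∈ Qs p (3 / 4)) (i j : Fin n) (a b : ℝ) :
    Integrable (fun y : Fin n → ℝ => (y i - a) * (y j - b)) (tl p x) := by
  have := tl_prob p hc hp hx
  have h := (((int_coord2 p hc hp hx i j).sub ((int_coord p hc hp hx i).mul_const b)).sub
    ((int_coord p hc hp hx j).const_mul a)).add (integrable_const (a * b))
  refine h.congr (Filter.Eventually.of_forall fun y => ?_)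
  simp only [Pi.add_apply, Pi.sub_apply]
  ring

lemma cov_eq {c : ℝ} (hc : 0 < c) (hp : ∀ x, c * ‖x‖ ≤ p x) {x : Fin n → ℝ} (hx : x ∈ Qs p (3 / 4)) (i j : Fin n) :
    cov p x i j = ∫ y, y i * y j ∂(tl p x) - bar p x i * bar p x j := by
  have := tl_prob p hc hp hx
  have h1 := int_coord2 p hc hp hx i j
  have h2 := (int_coord p hc hp hx i).mul_const (bar p x j)
  have h3 := (int_coord p hc hp hx j).const_mul (bar p x i)
  have e : (fun y : Fin n → ℝ => (y i - bar p x i) * (y j - bar p x j)) = fun y =>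
      y i * y j - y i * bar p x j - bar p x i * y j + bar p x i * bar p x j := by
    ext y; ring
  have h12 : Integrable (fun y : Fin n → ℝ => y i * y j - y i * bar p x j) (tl p x) := h1.sub h2
  have h123 : Integrable (fun y : Fin n → ℝ => y i * y j - y i * bar p x j - bar p x i * y j)
    (tl p x) := h12.sub h3
  rw [cov, e, integral_add h123 (integrable_const _), integral_sub h12 h3,
    integral_sub h1 h2, integral_mul_const, integral_const_mul]
  simp [bar]

lemma quad {c : ℝ} (hc : 0 < c) (hp : ∀ x, c * ‖x‖ ≤ p x) {x : Fin n → ℝ} (hx : x ∈ Qs p (3 / 4)) (v : Fin n → ℝ) :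
    Integrable (fun y => (v ⬝ᵥ (y - bar p x)) ^ 2) (tl p x) ∧
    ∫ y, (v ⬝ᵥ (y - bar p x)) ^ 2 ∂(tl p x) = v ⬝ᵥ (cov p x).mulVec v := by
  have e : (fun y => (v ⬝ᵥ (y - bar p x)) ^ 2) = fun y : Fin n → ℝ =>
      ∑ i, ∑ j, (v i * v j) * ((y i - bar p x i) * (y j - bar p x j)) := by
    ext y
    rw [sq, dotProduct, Finset.sum_mul_sum]
    refine Finset.sum_congr rfl fun i _ => Finset.sum_congr rfl fun j _ => ?_
    simp only [Pi.sub_apply]; ring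
  have hi : ∀ i j, Integrable (fun y : Fin n → ℝ =>
      (v i * v j) * ((y i - bar p x i) * (y j - bar p x j))) (tl p x) :=
    fun i j => (int_cov p hc hp hx i j _ _).const_mul _
  rw [e]
  refine ⟨integrable_finsetSum _ fun i _ => integrable_finsetSum _ fun j _ => hi i j, ?_⟩
  rw [integral_finsetSum _ fun i _ => integrable_finsetSum _ fun j _ => hi i j]
  simp only [dotProduct, Matrix.mulVec, Finset.mul_sum]
  refine Finset.sum_congr rfl fun i _ => ?_
  rw [integral_finsetSum _ fun j _ => hi i j]
  refine Finset.sum_congr rfl fun j _ => ?_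
  rw [integral_const_mul, cov]; ring

lemma quad_pos {c : ℝ} (hc : 0 < c) (hp : ∀ x, c * ‖x‖ ≤ p x) {x : Fin n → ℝ} (hx : x ∈ Qs p (3 / 4)) {v : Fin n → ℝ} (hv : v ≠ 0) :
    0 < v ⬝ᵥ (cov p x).mulVec v := by
  obtain ⟨h1, h2⟩ := quad p hc hp hx v
  rw [← h2, integral_pos_iff_support_of_nonneg (fun y => sq_nonneg _) h1]
  have hopen : IsOpen (Function.support fun y : Fin n → ℝ => (v ⬝ᵥ (y - bar p x)) ^ 2) :=
    Continuous.isOpen_support (by fun_prop)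
  have hne : (Function.support fun y : Fin n → ℝ => (v ⬝ᵥ (y - bar p x)) ^ 2).Nonempty := by
    refine ⟨bar p x + v, ?_⟩
    simp [hv]
  have hpos := hopen.measure_pos volume hne
  have hac := absolutelyContinuous_tilted (w_int1 p hc hp hx)
  refine pos_iff_ne_zero.2 fun h0 => hpos.ne' (hac h0)

lemma cov_posDef {c : ℝ} (hc : 0 < c) (hp : ∀ x, c * ‖x‖ ≤ p x) {x : Fin n → ℝ} (hx : x ∈ Qs p (3 / 4)) : (cov p x).PosDef := by
  refine Matrix.PosDef.of_dotProduct_mulVec_pos ?_ ?_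
  · ext i j
    simp only [Matrix.conjTranspose_apply, star_trivial, cov]
    congr 1; ext y; ring
  · intro v hv
    simpa using quad_pos p hc hp hx hv

lemma bar_deriv {c : ℝ} (hc : 0 < c) (hp : ∀ x, c * ‖x‖ ≤ p x) {x : Fin n → ℝ} (hx : x ∈ Qs p (1 / 2)) :
    HasFDerivAt (bar p) (LinearMap.toContinuousLinearMap (Matrix.toLin' (cov p x))) x := by
  have hx' : x ∈ Qs p (3 / 4) := mem_of_mem_nhds (nhds_Qs p hc hp hx)
  have hG := G_pos p hc hp hx'
  have dG := w_hasFDerivAt p hc hp hx (φ := fun _ => (1 : ℝ)) (by fun_prop) 1 0 (by simp)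
  simp only [mul_one] at dG
  refine hasFDerivAt_pi'' fun i => ?_
  have dM := w_hasFDerivAt p hc hp hx (φ := fun y => y i) (by fun_prop) 1 1 (fun y => by
    rw [one_mul, pow_one]; exact abs_coord y i)
  have hdiv := dM.mul ((hasDerivAt_inv hG.ne').comp_hasFDerivAt x dG)
  have efun : (fun x => bar p x i) = ((fun x => ∫ y, exp (x ⬝ᵥ y - p y) * y i) *
      ((fun t => t⁻¹) ∘ fun x => ∫ y, exp (x ⬝ᵥ y - p y))) := by
    ext z
    rw [bar, tl_integral]; simp [div_eq_mul_inv]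
  rw [efun]
  refine hdiv.congr_fderiv ?_
  have iL : ∀ φ : (Fin n → ℝ) → ℝ, Continuous φ → (∃ A : ℝ, ∃ k : ℕ, ∀ y, |φ y| ≤ A * (1 + ‖y‖) ^ k) →
      Integrable (fun y => exp (x ⬝ᵥ y - p y) • (φ y • Ld y)) := by
    rintro φ hφ ⟨A, k, hb⟩
    have hLc := Ld_cont (n := n)
    refine w_integrable p hc hp hx' (Continuous.aestronglyMeasurable (by fun_prop)) (A * n) (k + 1) ?_
    intro y
    have hA : 0 ≤ A * (1 + ‖y‖) ^ k := (abs_nonneg _).trans (hb y)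
    rw [norm_smul, Real.norm_eq_abs]
    calc |φ y| * ‖Ld y‖ ≤ (A * (1 + ‖y‖) ^ k) * (n * (1 + ‖y‖)) := by
          refine mul_le_mul (hb y) ((Ld_norm y).trans (by gcongr; linarith)) (norm_nonneg _) hA
      _ = _ := by ring
  have i1 := iL (fun _ => 1) (by fun_prop) ⟨1, 0, by simp⟩
  have i2 := iL (fun y => y i) (by fun_prop) ⟨1, 1, fun y => by
    rw [one_mul, pow_one]; exact abs_coord y i⟩
  have hcoord : ∀ j : Fin n, Integrable (fun y : Fin n → ℝ => exp (x ⬝ᵥ y - p y) * y j) := fun j =>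
    w_integrable p hc hp hx' (φ := fun y : Fin n → ℝ => y j) (Continuous.aestronglyMeasurable (by fun_prop)) 1 1 (fun y => by
      rw [Real.norm_eq_abs, one_mul, pow_one]; exact abs_coord y j)
  have hcoord2 : ∀ j : Fin n, Integrable (fun y : Fin n → ℝ => exp (x ⬝ᵥ y - p y) * (y i * y j)) := fun j =>
    w_integrable p hc hp hx' (φ := fun y : Fin n → ℝ => y i * y j) (Continuous.aestronglyMeasurable (by fun_prop)) 1 2 (fun y => by
      rw [Real.norm_eq_abs, one_mul, abs_mul, sq]
      exact mul_le_mul (abs_coord y i) (abs_coord y j) (abs_nonneg _) (by positivity))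
  ext v
  have a1 : (∫ y, exp (x ⬝ᵥ y - p y) • ((1 : ℝ) • Ld y)) v
      = ∑ j, (∫ y, exp (x ⬝ᵥ y - p y) * y j) * v j := by
    rw [ContinuousLinearMap.integral_apply i1]
    have e : ∀ y : Fin n → ℝ, (exp (x ⬝ᵥ y - p y) • ((1 : ℝ) • Ld y)) v
        = ∑ j, (exp (x ⬝ᵥ y - p y) * y j) * v j := by
      intro y
      rw [one_smul, smul_apply, Ld_apply, smul_eq_mul, dotProduct.eq_1 y v, Finset.mul_sum]
      exact Finset.sum_congr rfl fun j _ => by ring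
    simp_rw [e]
    rw [integral_finsetSum _ fun j _ => (hcoord j).mul_const (v j)]
    exact Finset.sum_congr rfl fun j _ => integral_mul_const _ _
  have a2 : (∫ y, exp (x ⬝ᵥ y - p y) • (y i • Ld y)) v
      = ∑ j, (∫ y, exp (x ⬝ᵥ y - p y) * (y i * y j)) * v j := by
    rw [ContinuousLinearMap.integral_apply i2]
    have e : ∀ y : Fin n → ℝ, (exp (x ⬝ᵥ y - p y) • (y i • Ld y)) v
        = ∑ j, (exp (x ⬝ᵥ y - p y) * (y i * y j)) * v j := by
      intro y
      rw [smul_apply, smul_apply, Ld_apply, smul_eq_mul, smul_eq_mul, dotProduct.eq_1 y v,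
        Finset.mul_sum, Finset.mul_sum]
      exact Finset.sum_congr rfl fun j _ => by ring
    simp_rw [e]
    rw [integral_finsetSum _ fun j _ => (hcoord2 j).mul_const (v j)]
    exact Finset.sum_congr rfl fun j _ => integral_mul_const _ _
  simp only [one_smul] at a1
  simp only [add_apply, smul_apply, smul_eq_mul, one_smul,
    Function.comp, ContinuousLinearMap.comp_apply, ContinuousLinearMap.proj_apply,
    LinearMap.coe_toContinuousLinearMap', Matrix.toLin'_apply, Matrix.mulVec]
  rw [a1, a2]
  simp only [Finset.mul_sum, dotProduct.eq_1 (cov p x i) v]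
  rw [← Finset.sum_add_distrib]
  refine Finset.sum_congr rfl fun j _ => ?_
  rw [cov_eq p hc hp hx', tl_integral, bar, bar, tl_integral, tl_integral]
  field_simp
  ring

end
end REPI

namespace REPI

section
variable {n : ℕ} (p : Seminorm ℝ (Fin n → ℝ))

lemma Qs_closed (t : ℝ) : IsClosed (Qs p t) := by
  have : Qs p t = ⋂ y, {x | x ⬝ᵥ y ≤ t * p y} := by ext x; simp [Qs]
  rw [this]
  exact isClosed_iInter fun y => isClosed_le (by fun_prop) (by fun_prop)

lemma Ks_closed (t : ℝ) : IsClosed (Ks p t) :=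
  isClosed_le (seminorm_cont p) continuous_const

lemma Ks_vol_lt_top {c : ℝ} (hc : 0 < c) (hp : ∀ x, c * ‖x‖ ≤ p x) (t : ℝ) : volume (Ks p t) < ⊤ := by
  refine lt_of_le_of_lt (measure_mono (t := Metric.closedBall 0 (t / c)) fun x hx => ?_)
    measure_closedBall_lt_top
  have h1 := hp x
  have h2 : p x ≤ t := hx
  simp only [Metric.mem_closedBall, dist_zero_right]
  rw [le_div_iff₀ hc]; linarith

lemma Ks_vol_pos {t : ℝ} (ht : 0 < t) : 0 < volume (Ks p t) := by
  have : (Ks p t) ∈ nhds (0 : Fin n → ℝ) := by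
    have h : {x | p x < t} ∈ nhds (0 : Fin n → ℝ) :=
      (isOpen_lt (seminorm_cont p) continuous_const).mem_nhds (by simpa using ht)
    exact Filter.mem_of_superset h fun x (hx : p x < t) => hx.le
  exact Measure.measure_pos_of_mem_nhds _ this

lemma Qs_vol_pos {c : ℝ} (hc : 0 < c) (hp : ∀ x, c * ‖x‖ ≤ p x) {t : ℝ} (ht : 0 < t) : 0 < volume (Qs p t) := by
  have : (Qs p t) ∈ nhds (0 : Fin n → ℝ) := by
    refine Filter.mem_of_superset (Metric.ball_mem_nhds 0 (ε := t * c / (n + 1)) (by positivity)) ?_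
    intro x hx y
    have h1 := (le_abs_self _).trans (abs_dot_le x y)
    have h2 : ‖x‖ < t * c / (n + 1) := by simpa using hx
    rw [lt_div_iff₀ (by positivity)] at h2
    have h3 : n * ‖x‖ ≤ t * c := by nlinarith [norm_nonneg x]
    have h4 := mul_le_mul_of_nonneg_right h3 (norm_nonneg y)
    nlinarith [mul_le_mul_of_nonneg_left (hp y) ht.le]
  exact Measure.measure_pos_of_mem_nhds _ this

lemma abs_dot_Qs {t : ℝ} {x : Fin n → ℝ} (hx : x ∈ Qs p t) (y : Fin n → ℝ) :
    |x ⬝ᵥ y| ≤ t * p y := by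
  refine abs_le.2 ⟨?_, hx y⟩
  have := hx (-y)
  rw [dotProduct_neg, map_neg_eq_map] at this
  linarith

lemma Qs_vol_lt_top (t : ℝ) : volume (Qs p t) < ⊤ := by
  refine lt_of_le_of_lt (measure_mono
    (t := Metric.closedBall 0 (∑ i : Fin n, |t| * p (Pi.single i 1))) fun x hx => ?_)
    measure_closedBall_lt_top
  simp only [Metric.mem_closedBall, dist_zero_right]
  refine (pi_norm_le_iff_of_nonneg (Finset.sum_nonneg fun i _ => by positivity)).2 fun i => ?_
  have h := abs_dot_Qs p hx (Pi.single i 1)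
  simp only [dotProduct_single, mul_one] at h
  rw [Real.norm_eq_abs]
  refine h.trans ?_
  refine le_trans ?_ (Finset.single_le_sum (f := fun i => |t| * p (Pi.single i 1))
    (fun i _ => by positivity) (Finset.mem_univ i))
  gcongr
  exact le_abs_self t

lemma Qs_convex (t : ℝ) : Convex ℝ (Qs p t) := by
  intro x hx y hy a b ha hb hab z
  rw [add_dotProduct, smul_dotProduct, smul_dotProduct, smul_eq_mul, smul_eq_mul]
  have h1 := mul_le_mul_of_nonneg_left (hx z) ha
  have h2 := mul_le_mul_of_nonneg_left (hy z) hb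
  have : t * p z = a * (t * p z) + b * (t * p z) := by rw [← add_mul, hab, one_mul]
  linarith

lemma bar_inj {c : ℝ} (hc : 0 < c) (hp : ∀ x, c * ‖x‖ ≤ p x) : Set.InjOn (bar p) (Qs p (1 / 2)) := by
  intro x hx z hz hxz
  by_contra hne
  set v := z - x with hv
  have hv0 : v ≠ 0 := sub_ne_zero.2 (Ne.symm hne)
  have hmem : ∀ t ∈ Set.Icc (0 : ℝ) 1, x + t • v ∈ Qs p (1 / 2) := by
    intro t ht
    have := (Qs_convex p (1 / 2)) hx hz (sub_nonneg.2 ht.2) ht.1 (by ring)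
    convert this using 1
    rw [hv]; module
  have hd : ∀ t ∈ Set.Icc (0 : ℝ) 1, HasDerivAt (fun t : ℝ => v ⬝ᵥ bar p (x + t • v))
      (v ⬝ᵥ (cov p (x + t • v)).mulVec v) t := by
    intro t ht
    have h1 := bar_deriv p hc hp (hmem t ht)
    have h2 : HasDerivAt (fun t : ℝ => x + t • v) v t := by
      simpa using ((hasDerivAt_id t).smul_const v).const_add x
    have h3 := (h1.comp_hasDerivAt t h2)
    have h4 := ((Ld v).hasFDerivAt).comp_hasDerivAt t h3
    simp only [LinearMap.coe_toContinuousLinearMap', Matrix.toLin'_apply, Ld_apply] at h4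
    refine h4.congr_of_eventuallyEq (Filter.Eventually.of_forall fun s => ?_)
    simp [Ld_apply]
  have hmono : StrictMonoOn (fun t : ℝ => v ⬝ᵥ bar p (x + t • v)) (Set.Icc 0 1) := by
    refine strictMonoOn_of_deriv_pos (convex_Icc 0 1)
      (fun t ht => (hd t ht).continuousAt.continuousWithinAt) fun t ht => ?_
    have ht' := interior_subset ht
    rw [(hd t ht').deriv]
    exact quad_pos p hc hp (mem_of_mem_nhds (nhds_Qs p hc hp (hmem t ht'))) hv0
  have := hmono (by simp) (by simp) (zero_lt_one' ℝ)
  simp only [zero_smul, add_zero, one_smul] at this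
  rw [hv, add_sub_cancel, hxz] at this
  exact lt_irrefl _ this

lemma int_exp_neg {c : ℝ} (hc : 0 < c) (hp : ∀ x, c * ‖x‖ ≤ p x) {a : ℝ} (ha : 0 < a) : Integrable (fun y : Fin n → ℝ => exp (-a * p y)) := by
  have hpc := seminorm_cont p
  refine (integrable_pow_exp (n := n) 0 (a := a * c) (by positivity)).mono'
    (Continuous.aestronglyMeasurable (by fun_prop)) (Filter.Eventually.of_forall fun y => ?_)
  rw [Real.norm_of_nonneg (exp_pos _).le, pow_zero, one_mul]
  apply exp_le_exp.2
  nlinarith [mul_le_mul_of_nonneg_left (hp y) ha.le]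

lemma exp_scale {a : ℝ} (ha : 0 < a) :
    ∫ y : Fin n → ℝ, exp (-a * p y) = (a ^ n)⁻¹ * ∫ y : Fin n → ℝ, exp (-p y) := by
  have := Measure.integral_comp_smul (volume : Measure (Fin n → ℝ)) (fun y => exp (-p y)) a
  simp only [map_smul_eq_mul, Real.norm_eq_abs, abs_of_pos ha, Module.finrank_fin_fun,
    smul_eq_mul] at this
  rw [abs_of_nonneg (by positivity)] at this
  rw [← this]
  congr 1; ext y; ring_nf

lemma p_bar {c : ℝ} (hc : 0 < c) (hp : ∀ x, c * ‖x‖ ≤ p x) (hn : 1 ≤ n) {x : Fin n → ℝ} (hx : x ∈ Qs p (1 / 2)) : p (bar p x) ≤ 8 * n := by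
  have hpc := seminorm_cont p
  have hx' : x ∈ Qs p (3 / 4) := mem_of_mem_nhds (nhds_Qs p hc hp hx)
  have := tl_prob p hc hp hx'
  have hG := G_pos p hc hp hx'
  obtain ⟨C, hC, hpC⟩ := seminorm_le p
  have hid : Integrable (fun y : Fin n → ℝ => y) (tl p x) :=
    tl_integrable p hc hp hx' (Continuous.aestronglyMeasurable (by fun_prop)) 1 1
      (fun y => by simp)
  have hbnd : ∀ y, ‖p y‖ ≤ C * (1 + ‖y‖) ^ 1 := fun y => by
    rw [Real.norm_of_nonneg (apply_nonneg _ _), pow_one]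
    exact (hpC y).trans (by gcongr; linarith)
  have hpi : Integrable p (tl p x) :=
    tl_integrable p hc hp hx' hpc.aestronglyMeasurable C 1 hbnd
  have hwp := w_integrable p hc hp hx' hpc.aestronglyMeasurable C 1 hbnd
  have hbar : bar p x = ∫ y, y ∂(tl p x) := by
    ext i
    rw [bar, eval_integral (fun j => int_coord p hc hp hx' j)]
  have h1 : p (bar p x) ≤ ∫ y, p y ∂(tl p x) := by
    rw [hbar]
    exact p.convexOn.map_integral_le hpc.continuousOn isClosed_univ
      (Filter.Eventually.of_forall fun _ => Set.mem_univ _) hid hpi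
  refine h1.trans ?_
  rw [tl_integral, div_le_iff₀ hG]
  have i1 := int_exp_neg p hc hp (a := 1 / 4) (by norm_num)
  have i0 := w_int1 p hc hp hx'
  have e1 := exp_scale p (a := 1 / 4) (by norm_num)
  have e2 := exp_scale p (a := 3 / 2) (by norm_num)
  have hGl : ∫ y, exp (-(3 / 2) * p y) ≤ ∫ y, exp (x ⬝ᵥ y - p y) := by
    refine integral_mono (int_exp_neg p hc hp (by norm_num)) i0 fun y => exp_le_exp.2 ?_
    have := (abs_le.1 (abs_dot_Qs p hx y)).1
    linarith
  have hmain : ∫ y, exp (x ⬝ᵥ y - p y) * p y ≤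
      ∫ y, ((4 * exp (-(2 * n))) * exp (-(1 / 4) * p y) + (8 * n - 4) * exp (x ⬝ᵥ y - p y)) := by
    refine integral_mono hwp ((i1.const_mul _).add (i0.const_mul _)) fun y => ?_
    have h1 := add_one_le_exp (p y / 4 - 2 * n)
    have h2 : exp (x ⬝ᵥ y - p y) * exp (p y / 4 - 2 * n) ≤ exp (-(2 * n)) * exp (-(1 / 4) * p y) := by
      rw [← exp_add, ← exp_add]
      apply exp_le_exp.2
      have := hx y
      linarith
    have h3 := mul_le_mul_of_nonneg_left h1 (exp_pos (x ⬝ᵥ y - p y)).le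
    simp only
    nlinarith
  rw [integral_add (i1.const_mul _) (i0.const_mul _), integral_const_mul, integral_const_mul] at hmain
  rw [e1] at hmain
  rw [e2] at hGl
  set I := ∫ y : Fin n → ℝ, exp (-p y)
  set G := ∫ y, exp (x ⬝ᵥ y - p y)
  have k1 : ((1 / 4 : ℝ) ^ n)⁻¹ = 6 ^ n * ((3 / 2 : ℝ) ^ n)⁻¹ := by
    rw [← inv_pow, ← inv_pow, ← mul_pow]; norm_num
  have k2 : exp (-(2 * n)) * (6 : ℝ) ^ n ≤ 1 := by
    have : (6 : ℝ) ^ n ≤ exp (2 * n) := by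
      rw [mul_comm, exp_nat_mul]
      gcongr
      have := exp_one_gt_d9
      have e : exp 2 = exp 1 * exp 1 := by rw [← exp_add]; norm_num
      rw [e]; nlinarith
    rw [exp_neg, inv_mul_le_iff₀ (exp_pos _)]; linarith
  have k3 : exp (-(2 * n)) * (((1 / 4 : ℝ) ^ n)⁻¹ * I) ≤ G := by
    rw [k1]
    have hI : 0 ≤ ((3 / 2 : ℝ) ^ n)⁻¹ * I := mul_nonneg (by positivity) (integral_nonneg fun y => (exp_pos _).le)
    calc exp (-(2 * n)) * (6 ^ n * ((3 / 2 : ℝ) ^ n)⁻¹ * I)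
        = (exp (-(2 * n)) * 6 ^ n) * (((3 / 2 : ℝ) ^ n)⁻¹ * I) := by ring
      _ ≤ 1 * (((3 / 2 : ℝ) ^ n)⁻¹ * I) := by gcongr
      _ ≤ G := by rw [one_mul]; exact hGl
  nlinarith

lemma det_bound {c : ℝ} (hc : 0 < c) (hp : ∀ x, c * ‖x‖ ≤ p x) (hn : 1 ≤ n) : ∃ x ∈ Qs p (1 / 2),
    ENNReal.ofReal (cov p x).det * volume (Qs p (1 / 2)) ≤ 2 * volume (Ks p (8 * n)) := by
  by_contra! hcon
  have hHpos := Qs_vol_pos p hc hp (t := 1 / 2) (by norm_num)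
  have hHtop := Qs_vol_lt_top p (1 / 2)
  have hKpos := Ks_vol_pos p (t := 8 * n) (by positivity)
  have hKtop := Ks_vol_lt_top p hc hp (8 * n)
  have hm := (Qs_closed p (1 / 2)).measurableSet
  have h1 := lintegral_abs_det_fderiv_eq_addHaar_image volume hm
    (fun x hx => (bar_deriv p hc hp hx).hasFDerivWithinAt) (bar_inj p hc hp)
  have h2 : volume (bar p '' Qs p (1 / 2)) ≤ volume (Ks p (8 * n)) := by
    refine measure_mono ?_
    rintro _ ⟨x, hx, rfl⟩
    exact p_bar p hc hp hn hx
  have h3 : 2 * volume (Ks p (8 * n)) ≤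
      ∫⁻ x in Qs p (1 / 2), ENNReal.ofReal |(LinearMap.toContinuousLinearMap
        (Matrix.toLin' (cov p x))).det| := by
    calc 2 * volume (Ks p (8 * n))
        = ∫⁻ x in Qs p (1 / 2), (2 * volume (Ks p (8 * n)) / volume (Qs p (1 / 2))) := by
          rw [setLIntegral_const, ENNReal.div_mul_cancel hHpos.ne' hHtop.ne]
      _ ≤ _ := by
          refine setLIntegral_mono' hm fun x hx => ?_
          rw [ENNReal.div_le_iff hHpos.ne' hHtop.ne]
          refine (hcon x hx).le.trans ?_
          gcongr
          have : (LinearMap.toContinuousLinearMap (Matrix.toLin' (cov p x))).det = (cov p x).det := by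
            rw [LinearMap.det_toContinuousLinearMap, LinearMap.det_toLin']
          rw [this]
          exact le_abs_self _
  rw [h1] at h3
  have h4 := h3.trans h2
  have h5 : volume (Ks p (8 * n)) < 2 * volume (Ks p (8 * n)) := by
    rw [two_mul]
    exact ENNReal.lt_add_right hKtop.ne hKpos.ne'
  exact absurd h4 (not_le.2 h5)

lemma tl_quasi {c : ℝ} (hc : 0 < c) (hp : ∀ x, c * ‖x‖ ≤ p x) {x : Fin n → ℝ} (hx : x ∈ Qs p (1 / 2)) (y : Fin n → ℝ) (S : Set (Fin n → ℝ))
    (hS : MeasurableSet S) :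
    ENNReal.ofReal (exp (-(3 / 2) * p y)) * tl p x S ≤ tl p x ((fun z => z - y) ⁻¹' S) := by
  have hpc := seminorm_cont p
  have hx' : x ∈ Qs p (3 / 4) := mem_of_mem_nhds (nhds_Qs p hc hp hx)
  have hG := G_pos p hc hp hx'
  have hS' : MeasurableSet ((fun z => z - y) ⁻¹' S) := measurable_sub_const y hS
  rw [tl, tilted_apply' _ _ hS, tilted_apply' _ _ hS']
  set G := ∫ y, exp (x ⬝ᵥ y - p y)
  rw [← lintegral_const_mul' _ _ ENNReal.ofReal_ne_top, ← lintegral_indicator hS,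
    ← lintegral_indicator hS', ← lintegral_add_right_eq_self _ y]
  rw [← lintegral_add_right_eq_self (fun a => ((fun z => z - y) ⁻¹' S).indicator _ a) y]
  rw [lintegral_add_right_eq_self]
  refine lintegral_mono fun z => ?_
  by_cases hz : z ∈ S
  · have hz' : z + y ∈ (fun z => z - y) ⁻¹' S := by simpa using hz
    rw [Set.indicator_of_mem hz, Set.indicator_of_mem hz', ← ENNReal.ofReal_mul (exp_pos _).le]
    apply ENNReal.ofReal_le_ofReal
    rw [← mul_div_assoc, ← exp_add]
    gcongr
    have h1 := (abs_le.1 (abs_dot_Qs p hx y)).1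
    have h2 := map_add_le_add p z y
    rw [dotProduct_add]
    linarith
  · rw [Set.indicator_of_notMem hz]; exact zero_le

end
end REPI

namespace REPI

lemma vol_smul_preimage {n : ℕ} {r : ℝ} (hr : 0 < r) (A A' : Set (Fin n → ℝ))
    (h : ∀ x, x ∈ A' ↔ r⁻¹ • x ∈ A) : volume A' = ENNReal.ofReal (r ^ n) * volume A := by
  have e : A' = (r⁻¹ • ·) ⁻¹' A := by ext x; exact h x
  rw [e, Measure.addHaar_preimage_smul _ (inv_ne_zero hr.ne'), Module.finrank_fin_fun, inv_pow,
    inv_inv, abs_of_pos (by positivity)]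

lemma vol_Bs {n : ℕ} {r : ℝ} (hr : 0 < r) :
    volume (Bs n r) = ENNReal.ofReal (r ^ n) * volume (Bs n 1) := by
  refine vol_smul_preimage hr _ _ fun x => ?_
  simp only [Bs, Set.mem_ofPred_eq, smul_dotProduct, dotProduct_smul, smul_eq_mul]
  rw [← mul_assoc, ← mul_inv, inv_mul_le_iff₀ (by positivity)]
  constructor <;> intro h <;> nlinarith

lemma vol_Ks {n : ℕ} (p : Seminorm ℝ (Fin n → ℝ)) {r : ℝ} (hr : 0 < r) :
    volume (Ks p r) = ENNReal.ofReal (r ^ n) * volume (Ks p 1) := by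
  refine vol_smul_preimage hr _ _ fun x => ?_
  simp only [Ks, Set.mem_ofPred_eq, map_smul_eq_mul, Real.norm_eq_abs]
  rw [abs_of_pos (by positivity), inv_mul_le_iff₀ hr, mul_one]

open scoped MatrixOrder in
lemma exists_sqrt {n : ℕ} {V : Matrix (Fin n) (Fin n) ℝ} (hV : V.PosDef) :
    ∃ B : Matrix (Fin n) (Fin n) ℝ, B * B = V ∧ B.transpose = B ∧ 0 < B.det ∧ B.det ^ 2 = V.det := by
  have h0 := hV.posSemidef.nonneg
  have h1 := CFC.sqrt_mul_sqrt_self V h0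
  have h2 : (CFC.sqrt V).PosSemidef := Matrix.nonneg_iff_posSemidef.1 (CFC.sqrt_nonneg V)
  have h3 : (CFC.sqrt V).det ^ 2 = V.det := by rw [sq, ← Matrix.det_mul, h1]
  refine ⟨CFC.sqrt V, h1, ?_, ?_, h3⟩
  · have := h2.1.eq
    rwa [Matrix.conjTranspose_eq_transpose_of_trivial] at this
  · refine lt_of_le_of_ne h2.det_nonneg fun h => ?_
    rw [← h] at h3
    have := hV.det_pos
    rw [← h3] at this
    norm_num at this

/-- Existence of an `M`-position. -/
theorem M_position {n : ℕ} (hn : 1 ≤ n) (p : Seminorm ℝ (Fin n → ℝ)) {c : ℝ} (hc : 0 < c)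
    (hp : ∀ x, c * ‖x‖ ≤ p x) :
    ∃ u : (Fin n → ℝ) →ₗ[ℝ] (Fin n → ℝ), LinearMap.det u = 1 ∧ ∃ r : ℝ, 0 < r ∧
      Cov (u '' Ks p 1) (Bs n r) (exp (12 * n)) ∧
      volume (Bs n r) ≤ ENNReal.ofReal ((64 * exp 72) ^ n) * volume (Ks p 1) := by
  obtain ⟨x, hx, hdet⟩ := det_bound p hc hp hn
  have hx' : x ∈ Qs p (3 / 4) := mem_of_mem_nhds (nhds_Qs p hc hp hx)
  have hprob := tl_prob p hc hp hx'
  have hn0 : (0 : ℝ) < n := by exact_mod_cast hn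
  obtain ⟨B, hBB, hBt, hBpos, hBdet⟩ := exists_sqrt (cov_posDef p hc hp hx')
  set V := cov p x with hV
  set s := B.det with hs
  have hBu : IsUnit B.det := hBpos.ne'.isUnit
  set T := B⁻¹ with hT
  have hTB : T * B = 1 := Matrix.nonsing_inv_mul _ hBu
  have hBT : B * T = 1 := Matrix.mul_nonsing_inv _ hBu
  have hTt : T.transpose = T := by rw [hT, Matrix.transpose_nonsing_inv, hBt]
  have hTdet : T.det = s⁻¹ := by rw [hT, Matrix.det_nonsing_inv, Ring.inverse_eq_inv']
  have hTV : T * V * T = 1 := by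
    rw [← hBB, ← Matrix.mul_assoc, hTB, Matrix.one_mul, hBT]
  -- the transported seminorm
  set p' : Seminorm ℝ (Fin n → ℝ) := p.comp (Matrix.toLin' B) with hp'
  have hp'a : ∀ y, p' y = p (B.mulVec y) := fun y => by simp [hp']
  have hTBv : ∀ y, T.mulVec (B.mulVec y) = y := fun y => by
    rw [Matrix.mulVec_mulVec, hTB, Matrix.one_mulVec]
  have hBTv : ∀ y, B.mulVec (T.mulVec y) = y := fun y => by
    rw [Matrix.mulVec_mulVec, hBT, Matrix.one_mulVec]
  obtain ⟨C, hC, hTC⟩ := seminorm_le ((normSeminorm ℝ (Fin n → ℝ)).comp (Matrix.toLin' T))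
  have hTC' : ∀ z, ‖T.mulVec z‖ ≤ C * ‖z‖ := fun z => by simpa using hTC z
  have hpc' : ∀ y, c / C * ‖y‖ ≤ p' y := by
    intro y
    have h1 := hTC' (B.mulVec y)
    rw [hTBv] at h1
    have h2 := hp (B.mulVec y)
    rw [hp'a]
    refine le_trans ?_ h2
    rw [div_mul_eq_mul_div, div_le_iff₀ hC]
    nlinarith
  have hTm : Measurable (T.mulVec) := by
    have : Continuous (Matrix.toLin' T) := LinearMap.continuous_of_finiteDimensional _
    have h2 : Measurable (Matrix.toLin' T) := this.measurable
    exact h2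
  set ν := Measure.map T.mulVec (tl p x) with hν
  have hνp : IsProbabilityMeasure ν := Measure.isProbabilityMeasure_map hTm.aemeasurable
  have hquasi : ∀ (y : Fin n → ℝ) (S : Set (Fin n → ℝ)), MeasurableSet S →
      ENNReal.ofReal (exp (-(3 / 2) * p' y)) * ν S ≤ ν ((fun z => z - y) ⁻¹' S) := by
    intro y S hS
    rw [hν, Measure.map_apply hTm hS, Measure.map_apply hTm (measurable_sub_const y hS)]
    refine (tl_quasi p hc hp hx (B.mulVec y) _ (hTm hS)).trans (le_of_eq ?_)
    congr 1
    ext z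
    simp [Matrix.mulVec_sub, hTBv]
  set R := 2 * √n with hR
  have hsn : 0 < √(n : ℝ) := by positivity
  have hsq : √(n : ℝ) * √n = n := Real.mul_self_sqrt hn0.le
  have hRpos : 0 < R := by positivity
  have hb : ENNReal.ofReal (3 / 4) ≤ ν {z | z - T.mulVec (bar p x) ∈ Bs n R} := by
    have hmB : MeasurableSet {z | z - T.mulVec (bar p x) ∈ Bs n R} := by
      have hcl : IsClosed {z : Fin n → ℝ | (z - T.mulVec (bar p x)) ⬝ᵥ (z - T.mulVec (bar p x)) ≤ R ^ 2} :=
        isClosed_le (by fun_prop) continuous_const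
      exact hcl.measurableSet
    rw [hν, Measure.map_apply hTm hmB]
    set F : (Fin n → ℝ) → ℝ := fun y => ∑ i, ((T i) ⬝ᵥ (y - bar p x)) ^ 2 with hF
    have hFi : Integrable F (tl p x) := integrable_finsetSum _ fun i _ => (quad p hc hp hx' (T i)).1
    have hFn : ∫ y, F y ∂(tl p x) = n := by
      rw [hF, integral_finsetSum _ fun i _ => (quad p hc hp hx' (T i)).1]
      simp_rw [(quad p hc hp hx' _).2]
      have : ∀ i, T i ⬝ᵥ V.mulVec (T i) = 1 := by
        intro i
        have h1 := congrFun (congrFun hTV i) i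
        rw [Matrix.one_apply_eq, Matrix.mul_assoc, Matrix.mul_apply] at h1
        rw [← h1, dotProduct]
        refine Finset.sum_congr rfl fun j _ => ?_
        congr 1
        rw [Matrix.mulVec, Matrix.mul_apply, dotProduct]
        refine Finset.sum_congr rfl fun k _ => ?_
        congr 1
        exact congrFun (congrFun hTt k) i
      simp_rw [← hV, this]
      simp
    have h1 := mul_meas_ge_le_integral_of_nonneg
      (Filter.Eventually.of_forall fun y => Finset.sum_nonneg fun i _ => sq_nonneg _) hFi (4 * n)
    rw [hFn] at h1
    have hFm : MeasurableSet {y | 4 * n ≤ F y} :=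
      (isClosed_le continuous_const (by fun_prop)).measurableSet
    have h2 : (tl p x).real {y | 4 * n ≤ F y} ≤ 1 / 4 := by nlinarith
    have h3 := probReal_compl_eq_one_sub (μ := tl p x) hFm
    have h4 : 3 / 4 ≤ (tl p x).real {y | 4 * n ≤ F y}ᶜ := by rw [h3]; linarith
    have h5 : ENNReal.ofReal (3 / 4) ≤ (tl p x) {y | 4 * n ≤ F y}ᶜ := by
      rw [← ofReal_measureReal]
      exact ENNReal.ofReal_le_ofReal h4
    refine h5.trans (measure_mono fun y hy => ?_)
    have hy' : F y < 4 * n := by simpa using hy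
    have e : F y = (T.mulVec y - T.mulVec (bar p x)) ⬝ᵥ (T.mulVec y - T.mulVec (bar p x)) := by
      rw [← Matrix.mulVec_sub, hF, dotProduct]
      exact Finset.sum_congr rfl fun i _ => by rw [sq]; rfl
    show (T.mulVec y - T.mulVec (bar p x)) ⬝ᵥ (T.mulVec y - T.mulVec (bar p x)) ≤ R ^ 2
    rw [← e, hR]
    nlinarith
  have hcov : ∀ t : ℝ, 0 < t → Cov (Ks p' 1) (Bs n t) (exp (6 * R / t)) := fun t ht =>
    cov_K p' ν hquasi _ hRpos hb ht
  have hdual := (cov_dual p' (div_pos hc hC) hpc' hRpos hcov (t := R / n) (by positivity)).volume_le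
  have e72 : 72 * R / (R / n) = 72 * n := by field_simp
  rw [e72] at hdual
  -- volume of the polar
  have hQ : volume (Qs p' (R / n)) = ENNReal.ofReal ((2 * (R / n)) ^ n * s) * volume (Qs p (1 / 2)) := by
    set a := (2 * (R / n)) with ha
    have hapos : 0 < a := by positivity
    have hd : LinearMap.det (Matrix.toLin' (a⁻¹ • T)) = (a ^ n)⁻¹ * s⁻¹ := by
      rw [LinearMap.det_toLin', Matrix.det_smul, hTdet, Fintype.card_fin, inv_pow]
    have h1 := Measure.addHaar_preimage_linearMap volume (f := Matrix.toLin' (a⁻¹ • T))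
      (by rw [hd]; positivity) (Qs p (1 / 2))
    rw [hd, ← mul_inv, inv_inv, abs_of_pos (by positivity)] at h1
    rw [← h1]
    congr 1
    ext z
    simp only [Qs, Set.mem_preimage, Set.mem_ofPred_eq, Matrix.toLin'_apply, Matrix.smul_mulVec,
      smul_dotProduct, smul_eq_mul]
    have e : ∀ y, T.mulVec z ⬝ᵥ y = z ⬝ᵥ T.mulVec y := by
      intro y
      rw [Matrix.dotProduct_mulVec, ← Matrix.mulVec_transpose, hTt]
    have hRn : R / n = a / 2 := by rw [ha]; ring
    rw [hRn]
    constructor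
    · intro h y
      have := h (T.mulVec y)
      rw [hp'a, hBTv] at this
      rw [e, inv_mul_le_iff₀ hapos]; linarith
    · intro h y
      have := h (B.mulVec y)
      rw [e, hTBv, inv_mul_le_iff₀ hapos] at this
      rw [hp'a]; linarith
  -- normalisation
  set σ := s ^ ((n : ℝ)⁻¹) with hσ
  have hσpos : 0 < σ := Real.rpow_pos_of_pos hBpos _
  have hσn : σ ^ n = s := Real.rpow_inv_natCast_pow hBpos.le (by lia)
  refine ⟨Matrix.toLin' (σ • T), ?_, σ * (1 / √n), by positivity, ?_, ?_⟩
  · rw [LinearMap.det_toLin', Matrix.det_smul, hTdet, Fintype.card_fin, hσn]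
    exact mul_inv_cancel₀ hBpos.ne'
  · have h1 := hcov (1 / √n) (by positivity)
    have e12 : 6 * R / (1 / √n) = 12 * n := by
      rw [hR, div_div_eq_mul_div, div_one]; linear_combination 12 * hsq
    rw [e12] at h1
    refine h1.image_smul hσpos.ne' ?_ fun z hz => smul_mem_Bs hz
    rintro _ ⟨z, hz, rfl⟩
    show p' _ ≤ 1
    rw [Matrix.toLin'_apply, Matrix.smul_mulVec, smul_smul, inv_mul_cancel₀ hσpos.ne', one_smul,
      hp'a, hBTv]
    exact hz
  · rw [hQ] at hdual
    rw [vol_Bs (by positivity), mul_pow, hσn]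
    rw [← hBdet, vol_Ks p (by positivity)] at hdet
    calc ENNReal.ofReal (s * (1 / √n) ^ n) * volume (Bs n 1)
        ≤ ENNReal.ofReal (s * (1 / √n) ^ n) * (ENNReal.ofReal (exp (72 * n)) *
          (ENNReal.ofReal ((2 * (R / n)) ^ n * s) * volume (Qs p (1 / 2)))) := by gcongr
      _ = ENNReal.ofReal ((1 / √n) ^ n * exp (72 * n) * (2 * (R / n)) ^ n) *
          (ENNReal.ofReal (s ^ 2) * volume (Qs p (1 / 2))) := by
          rw [← mul_assoc, ← mul_assoc, ← mul_assoc, ← ENNReal.ofReal_mul (by positivity),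
            ← ENNReal.ofReal_mul (by positivity), ← ENNReal.ofReal_mul (by positivity)]
          congr 2; ring
      _ ≤ ENNReal.ofReal ((1 / √n) ^ n * exp (72 * n) * (2 * (R / n)) ^ n) *
          (2 * (ENNReal.ofReal ((8 * n) ^ n) * volume (Ks p 1))) := by gcongr
      _ = ENNReal.ofReal ((1 / √n) ^ n * exp (72 * n) * (2 * (R / n)) ^ n * 2 * (8 * n) ^ n)
          * volume (Ks p 1) := by
          rw [ENNReal.ofReal_mul (q := (8 * (n:ℝ)) ^ n) (by positivity),
            ENNReal.ofReal_mul (q := 2) (by positivity)]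
          simp [mul_assoc]
      _ ≤ _ := by
          gcongr
          have e1 : exp (72 * n) = exp 72 ^ n := by rw [mul_comm, exp_nat_mul]
          have e2 : (1 / √n) * (2 * (R / n)) * (8 * n) = (32 : ℝ) := by
            rw [hR]; field_simp; norm_num
          have e3 : (1 / √n) ^ n * exp (72 * n) * (2 * (R / n)) ^ n * 2 * (8 * n) ^ n
              = (32 * exp 72) ^ n * 2 := by
            rw [e1, ← e2]; simp only [mul_pow]; ring
          rw [e3]
          have e4 : (2 : ℝ) ≤ 2 ^ n := by
            calc (2 : ℝ) = 2 ^ 1 := by norm_num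
              _ ≤ 2 ^ n := pow_le_pow_right₀ (by norm_num) hn
          calc (32 * exp 72) ^ n * 2 ≤ (32 * exp 72) ^ n * 2 ^ n := by gcongr
            _ = _ := by rw [← mul_pow]; ring_nf

end REPI

namespace REPI

lemma vol_affine {n : ℕ} {r : ℝ} (hr : 0 < r) (v : Fin n → ℝ) (A A' : Set (Fin n → ℝ))
    (h : ∀ a ∈ A, v + r • a ∈ A') : ENNReal.ofReal (r ^ n) * volume A ≤ volume A' := by
  have h1 : volume A ≤ volume ((r • ·) ⁻¹' ((v + ·) ⁻¹' A')) := measure_mono fun a ha => h a ha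
  rw [Measure.addHaar_preimage_smul _ hr.ne', measure_preimage_add, Module.finrank_fin_fun,
    abs_of_pos (by positivity), ENNReal.ofReal_inv_of_pos (by positivity)] at h1
  calc ENNReal.ofReal (r ^ n) * volume A
      ≤ ENNReal.ofReal (r ^ n) * ((ENNReal.ofReal (r ^ n))⁻¹ * volume A') := by gcongr
    _ = volume A' := by
      rw [← mul_assoc, ENNReal.mul_inv_cancel (by simpa using (pow_pos hr n)) ENNReal.ofReal_ne_top,
        one_mul]

section
variable {n : ℕ} {f : (Fin n → ℝ) → ℝ}

lemma markov (hf0 : ∀ x, 0 ≤ f x) (hfm : Measurable f) (hf1 : ∫⁻ x, ENNReal.ofReal (f x) = 1)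
    (ε : ℝ) : ENNReal.ofReal ε * volume {x | ε ≤ f x} ≤ 1 := by
  have h := mul_meas_ge_le_lintegral (μ := volume) hfm.ennreal_ofReal (ENNReal.ofReal ε)
  rw [hf1] at h
  simpa [ENNReal.ofReal_le_ofReal_iff (hf0 _)] using h

lemma pos_level (hf1 : ∫⁻ x, ENNReal.ofReal (f x) = 1) :
    ∃ ε : ℝ, 0 < ε ∧ 0 < volume {x | ε ≤ f x} := by
  by_contra! hcon
  have h0 : volume (⋃ k : ℕ, {x | 1 / ((k : ℝ) + 1) ≤ f x}) = 0 :=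
    measure_iUnion_null fun k => le_antisymm (hcon _ (by positivity)) zero_le
  have h1 : ∀ᵐ x, f x ≤ 0 := by
    refine measure_mono_null (fun x hx => ?_) h0
    have hx' : 0 < f x := by simpa using hx
    obtain ⟨k, hk⟩ := exists_nat_one_div_lt hx'
    exact Set.mem_iUnion.2 ⟨k, hk.le⟩
  have h2 : ∫⁻ x, ENNReal.ofReal (f x) = 0 := by
    rw [← lintegral_zero (μ := (volume : Measure (Fin n → ℝ)))]
    refine lintegral_congr_ae ?_
    filter_upwards [h1] with x hx
    exact ENNReal.ofReal_of_nonpos hx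
  rw [h2] at hf1
  exact zero_ne_one hf1

lemma lc_bdd (hlc : IsLogConcaveFn f) (hfm : Measurable f)
    (hf1 : ∫⁻ x, ENNReal.ofReal (f x) = 1) : ∃ M : ℝ, ∀ x, f x ≤ M := by
  obtain ⟨hf0, hl⟩ := hlc
  obtain ⟨ε, hε, hA⟩ := pos_level hf1
  have hAtop : volume {x | ε ≤ f x} ≠ ⊤ := by
    intro h
    have := markov hf0 hfm hf1 ε
    rw [h, ENNReal.mul_top (by simpa using hε)] at this
    simp at this
  set a := (volume {x | ε ≤ f x}).toReal with ha
  have hapos : 0 < a := ENNReal.toReal_pos hA.ne' hAtop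
  refine ⟨(2 ^ n / a) ^ 2 / ε, fun x => ?_⟩
  set δ := f x ^ (1 / 2 : ℝ) * ε ^ (1 - 1 / 2 : ℝ) with hδ
  have hδ2 : δ ^ 2 = f x * ε := by
    rw [hδ, mul_pow, ← Real.rpow_natCast, ← Real.rpow_natCast, ← Real.rpow_mul (hf0 x),
      ← Real.rpow_mul hε.le]
    norm_num
  have hδ0 : 0 ≤ δ := mul_nonneg (Real.rpow_nonneg (hf0 x) _) (Real.rpow_nonneg hε.le _)
  have h1 := vol_affine (r := 1 / 2) (by norm_num) ((1 / 2 : ℝ) • x) {x | ε ≤ f x} {x | δ ≤ f x} (by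
    intro z hz
    have h := hl x z (1 / 2) (by norm_num) (by norm_num)
    have e : (1 - 1 / 2 : ℝ) = 1 / 2 := by norm_num
    refine le_trans ?_ (h.trans_eq (by rw [e]))
    rw [hδ]
    exact mul_le_mul_of_nonneg_left (Real.rpow_le_rpow hε.le hz (by norm_num))
      (Real.rpow_nonneg (hf0 x) _))
  have h2 := markov hf0 hfm hf1 δ
  have h3 : ENNReal.ofReal (δ * ((1 / 2) ^ n * a)) ≤ 1 := by
    rw [ENNReal.ofReal_mul hδ0, ENNReal.ofReal_mul (q := a) (by positivity), ha,
      ENNReal.ofReal_toReal hAtop]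
    exact le_trans (by gcongr) h2
  have h4 : δ * ((1 / 2) ^ n * a) ≤ 1 := by
    rwa [ENNReal.ofReal_le_one] at h3
  have h5 : δ ≤ 2 ^ n / a := by
    rw [le_div_iff₀ hapos]
    have : (1 / 2 : ℝ) ^ n * 2 ^ n = 1 := by rw [← mul_pow]; norm_num
    calc δ * a = (δ * ((1 / 2) ^ n * a)) * 2 ^ n := by
          linear_combination (-(δ * a)) * this
      _ ≤ 1 * 2 ^ n := by gcongr
      _ = _ := one_mul _
  rw [le_div_iff₀ hε, ← hδ2]
  gcongr

/-- difference body volume (weak Rogers–Shephard) -/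
lemma diff_vol {K : Set (Fin n → ℝ)} (hK : Convex ℝ K) (hm : MeasurableSet K)
    (h0 : 0 < volume K) (ht : volume K ≠ ⊤) :
    volume {z | ∃ a ∈ K, ∃ b ∈ K, z = a - b} ≤ ENNReal.ofReal (4 ^ n) * volume K := by
  set φ : (Fin n → ℝ) → ℝ≥0∞ := fun x => volume (K ∩ {y | y - x ∈ K}) with hφ
  have hS : MeasurableSet {q : (Fin n → ℝ) × (Fin n → ℝ) | q.2 ∈ K ∧ q.2 - q.1 ∈ K} :=
    (measurable_snd hm).inter ((measurable_snd.sub measurable_fst) hm)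
  have hφm : Measurable φ := measurable_measure_prodMk_left hS
  have hhI : ∫⁻ x, φ x = volume K * volume K := by
    have h1 := Measure.prod_apply (μ := (volume : Measure (Fin n → ℝ)))
      (ν := (volume : Measure (Fin n → ℝ))) hS
    have h2 := Measure.prod_apply_symm (μ := (volume : Measure (Fin n → ℝ)))
      (ν := (volume : Measure (Fin n → ℝ))) hS
    have h3 : ∫⁻ x, φ x = ∫⁻ y, volume ((fun x => (x, y)) ⁻¹'
        {q : (Fin n → ℝ) × (Fin n → ℝ) | q.2 ∈ K ∧ q.2 - q.1 ∈ K}) := by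
      rw [← h2, h1]; rfl
    rw [h3]
    have h4 : ∀ y : Fin n → ℝ, volume ((fun x => (x, y)) ⁻¹'
        {q : (Fin n → ℝ) × (Fin n → ℝ) | q.2 ∈ K ∧ q.2 - q.1 ∈ K})
        = K.indicator (fun _ => volume K) y := by
      intro y
      by_cases hy : y ∈ K
      · rw [Set.indicator_of_mem hy]
        have e : ((fun x => (x, y)) ⁻¹'
          {q : (Fin n → ℝ) × (Fin n → ℝ) | q.2 ∈ K ∧ q.2 - q.1 ∈ K}) = (fun x => y - x) ⁻¹' K := by
          ext x; simp [hy]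
        rw [e]
        exact (Measure.measurePreserving_sub_left volume y).measure_preimage hm.nullMeasurableSet
      · rw [Set.indicator_of_notMem hy]
        have e : ((fun x => (x, y)) ⁻¹'
          {q : (Fin n → ℝ) × (Fin n → ℝ) | q.2 ∈ K ∧ q.2 - q.1 ∈ K}) = ∅ := by
          ext x; simp [hy]
        rw [e, measure_empty]
    simp_rw [h4]
    rw [lintegral_indicator hm, setLIntegral_const]
  set D := {x | ENNReal.ofReal ((1 / 2) ^ n) * volume K ≤ φ x} with hD
  have h1 := mul_meas_ge_le_lintegral (μ := volume) hφm (ENNReal.ofReal ((1 / 2) ^ n) * volume K)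
  rw [hhI] at h1
  have h2 := vol_affine (r := 1 / 2) (by norm_num) 0 {z | ∃ a ∈ K, ∃ b ∈ K, z = a - b} D (by
    rintro _ ⟨a, ha, b, hb, rfl⟩
    refine vol_affine (r := 1 / 2) (by norm_num) ((1 / 2 : ℝ) • a) K _ fun z hz => ⟨?_, ?_⟩
    · exact hK ha hz (by norm_num) (by norm_num) (by norm_num)
    · have := hK hb hz (a := 1 / 2) (b := 1 / 2) (by norm_num) (by norm_num) (by norm_num)
      show (1 / 2 : ℝ) • a + (1 / 2 : ℝ) • z - (0 + (1 / 2 : ℝ) • (a - b)) ∈ K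
      convert this using 1
      module)
  have h3 : volume K * (ENNReal.ofReal ((1 / 2) ^ n) * volume D) ≤ volume K * volume K := by
    refine le_trans (le_of_eq ?_) h1
    rw [hD]; ring
  have h4 : ENNReal.ofReal ((1 / 2) ^ n) * volume D ≤ volume K :=
    (ENNReal.mul_le_mul_iff_right h0.ne' ht).1 h3
  set W := {z | ∃ a ∈ K, ∃ b ∈ K, z = a - b}
  have e : ENNReal.ofReal (4 ^ n) * (ENNReal.ofReal ((1 / 2) ^ n) * ENNReal.ofReal ((1 / 2) ^ n)) = 1 := by
    rw [← ENNReal.ofReal_mul (by positivity), ← ENNReal.ofReal_mul (by positivity), ← mul_pow,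
      ← mul_pow]
    norm_num
  calc volume W = ENNReal.ofReal (4 ^ n) * (ENNReal.ofReal ((1 / 2) ^ n) *
        (ENNReal.ofReal ((1 / 2) ^ n) * volume W)) := by
        rw [← mul_assoc (ENNReal.ofReal ((1 / 2) ^ n)), ← mul_assoc, e, one_mul]
    _ ≤ ENNReal.ofReal (4 ^ n) * (ENNReal.ofReal ((1 / 2) ^ n) * volume D) := by gcongr
    _ ≤ _ := by gcongr

/-- A seminorm whose unit ball has finite volume is a norm. -/
lemma norm_of_vol (hn : 1 ≤ n) (p : Seminorm ℝ (Fin n → ℝ)) (h : volume (Ks p 1) ≠ ⊤) :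
    ∃ c : ℝ, 0 < c ∧ ∀ x, c * ‖x‖ ≤ p x := by
  have hpos : ∀ y, y ≠ 0 → 0 < p y := by
    intro y hy
    refine lt_of_le_of_ne (apply_nonneg _ _) fun h0 => h ?_
    obtain ⟨C, hC, hpC⟩ := seminorm_le p
    have hy' : 0 < ‖y‖ := norm_pos_iff.2 hy
    set ρ := 1 / C with hρ
    have hρpos : 0 < ρ := by positivity
    set v := (2 * ρ / ‖y‖) • y with hv
    have hvn : ‖v‖ = 2 * ρ := by
      rw [hv, norm_smul, Real.norm_of_nonneg (by positivity)]; field_simp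
    have hpv : p v = 0 := by rw [hv, map_smul_eq_mul, ← h0, mul_zero]
    by_contra hfin
    have hdisj : Pairwise (Function.onFun Disjoint fun k : ℕ => Metric.ball ((k : ℝ) • v) ρ) := by
      intro i j hij
      refine Metric.ball_disjoint_ball ?_
      rw [dist_eq_norm, ← sub_smul, norm_smul, hvn, Real.norm_eq_abs]
      have : (1 : ℝ) ≤ |(i : ℝ) - j| := by
        have h1 : (1 : ℤ) ≤ |(i : ℤ) - j| := Int.one_le_abs (sub_ne_zero.2 (by exact_mod_cast hij))
        exact_mod_cast h1
      nlinarith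
    have h1 := measure_iUnion (μ := volume) hdisj fun k => measurableSet_ball
    have h2 : volume (⋃ k : ℕ, Metric.ball ((k : ℝ) • v) ρ) ≤ volume (Ks p 1) := by
      refine measure_mono (Set.iUnion_subset fun k z hz => ?_)
      show p z ≤ 1
      have h3 : ‖z - (k : ℝ) • v‖ < ρ := by simpa [dist_eq_norm] using hz
      have h4 : p z ≤ p (z - (k : ℝ) • v) + p ((k : ℝ) • v) := by
        have := map_add_le_add p (z - (k : ℝ) • v) ((k : ℝ) • v)
        rwa [sub_add_cancel] at this
      rw [map_smul_eq_mul, hpv, mul_zero, add_zero] at h4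
      refine (h4.trans (hpC _)).trans ?_
      have : C * ρ = 1 := by rw [hρ]; field_simp
      nlinarith
    rw [h1] at h2
    have h5 : ∀ k : ℕ, volume (Metric.ball ((k : ℝ) • v) ρ) = volume (Metric.ball (0 : Fin n → ℝ) ρ) :=
      fun k => Measure.addHaar_ball_center _ _ _
    simp_rw [h5] at h2
    rw [ENNReal.tsum_const_eq_top_of_ne_zero (Metric.measure_ball_pos _ _ hρpos).ne'] at h2
    exact hfin (top_le_iff.1 h2)
  have hne : (Metric.sphere (0 : Fin n → ℝ) 1).Nonempty := by
    refine ⟨Pi.single (⟨0, hn⟩ : Fin n) 1, ?_⟩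
    rw [mem_sphere_zero_iff_norm, Pi.norm_single, norm_one]
  obtain ⟨z, hz, hmin⟩ := (isCompact_sphere (0 : Fin n → ℝ) 1).exists_isMinOn hne
    (seminorm_cont p).continuousOn
  have hz1 : ‖z‖ = 1 := by simpa using hz
  refine ⟨p z, hpos z (by rw [← norm_pos_iff, hz1]; norm_num), fun x => ?_⟩
  by_cases hx : x = 0
  · simp [hx]
  have hxn : 0 < ‖x‖ := norm_pos_iff.2 hx
  have := hmin (show ‖x‖⁻¹ • x ∈ Metric.sphere (0 : Fin n → ℝ) 1 by
    simp [norm_smul, hxn.ne'])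
  simp only [Set.mem_ofPred_eq, map_smul_eq_mul, norm_inv, norm_norm] at this
  rw [inv_mul_eq_div, le_div_iff₀ hxn] at this
  exact this

/-- symmetric seminorm from a convex set -/
lemma exists_gauge (hn : 1 ≤ n) {K : Set (Fin n → ℝ)} (hK : Convex ℝ K) (hm : MeasurableSet K)
    (h0 : 0 < volume K) (ht : volume K ≠ ⊤) :
    ∃ p : Seminorm ℝ (Fin n → ℝ), (∃ c : ℝ, 0 < c ∧ ∀ x, c * ‖x‖ ≤ p x) ∧
      (∀ a ∈ K, ∀ b ∈ K, p (a - b) ≤ 1) ∧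
      volume (Ks p 1) ≤ ENNReal.ofReal (8 ^ n) * volume K := by
  set W := {z | ∃ a ∈ K, ∃ b ∈ K, z = a - b} with hW
  have hWc : Convex ℝ W := by
    rintro _ ⟨a, ha, b, hb, rfl⟩ _ ⟨a', ha', b', hb', rfl⟩ s t hs ht hst
    exact ⟨s • a + t • a', hK ha ha' hs ht hst, s • b + t • b', hK hb hb' hs ht hst, by module⟩
  have hWneg : ∀ x ∈ W, -x ∈ W := by
    rintro _ ⟨a, ha, b, hb, rfl⟩
    exact ⟨b, hb, a, ha, by simp⟩
  have hWn : W ∈ nhds (0 : Fin n → ℝ) := by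
    have := Measure.sub_mem_nhds_zero_of_addHaar_pos volume K hm h0
    refine Filter.mem_of_superset this ?_
    rintro _ ⟨a, ha, b, hb, rfl⟩
    exact ⟨a, ha, b, hb, rfl⟩
  have hW0 : (0 : Fin n → ℝ) ∈ W := mem_of_mem_nhds hWn
  have hWa : Absorbent ℝ W := absorbent_nhds_zero hWn
  have hWb : Balanced ℝ W := by
    intro r hr
    rintro _ ⟨x, hx, rfl⟩
    rw [Real.norm_eq_abs] at hr
    have hr' := abs_le.1 hr
    have := hWc hx (hWneg x hx) (a := (1 + r) / 2) (b := (1 - r) / 2) (by linarith) (by linarith)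
      (by ring)
    convert this using 1
    simp only
    module
  set p := gaugeSeminorm hWb hWc hWa with hp
  have hlt : ∀ x, p x < 1 → x ∈ W := fun x hx => setOfPred_gauge_lt_one_subset_self hWc hW0 hWa hx
  have hvol : volume (Ks p 1) ≤ ENNReal.ofReal (8 ^ n) * volume K := by
    have h1 := vol_affine (r := 1 / 2) (by norm_num) 0 (Ks p 1) W (by
      intro a ha
      apply hlt
      have ha' : p a ≤ 1 := ha
      rw [zero_add, map_smul_eq_mul, Real.norm_of_nonneg (by norm_num)]
      linarith)
    have h2 := diff_vol hK hm h0 ht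
    have e : ENNReal.ofReal (2 ^ n) * ENNReal.ofReal ((1 / 2) ^ n) = 1 := by
      rw [← ENNReal.ofReal_mul (by positivity), ← mul_pow]; norm_num
    calc volume (Ks p 1) = ENNReal.ofReal (2 ^ n) * (ENNReal.ofReal ((1 / 2) ^ n) * volume (Ks p 1)) := by
          rw [← mul_assoc, e, one_mul]
      _ ≤ ENNReal.ofReal (2 ^ n) * (ENNReal.ofReal (4 ^ n) * volume K) := by
          exact mul_le_mul' le_rfl (h1.trans h2)
      _ = _ := by
          rw [← mul_assoc, ← ENNReal.ofReal_mul (by positivity), ← mul_pow]; norm_num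
  refine ⟨p, norm_of_vol hn p ?_, ?_, hvol⟩
  · exact (lt_of_le_of_lt hvol (ENNReal.mul_lt_top ENNReal.ofReal_lt_top (lt_top_iff_ne_top.2 ht))).ne
  · intro a ha b hb
    exact gauge_le_one_of_mem ⟨a, ha, b, hb, rfl⟩

end
end REPI

namespace REPI
variable {n : ℕ}

lemma lt_one_vol (p : Seminorm ℝ (Fin n → ℝ)) {c : ℝ} (hc : 0 < c) (hp : ∀ x, c * ‖x‖ ≤ p x) :
    volume {x | p x < 1} = ENNReal.ofReal ((∫ x, exp (-p x)) / n.factorial) := by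
  have h := measure_lt_one_eq_integral_div_gamma (μ := (volume : Measure (Fin n → ℝ)))
    (g := p) (map_zero p) (map_neg_eq_map p) (map_add_le_add p) (fun {x} hx => by
      have h1 := hp x
      rw [hx] at h1
      have h2 : ‖x‖ ≤ 0 := by nlinarith [norm_nonneg x]
      exact norm_le_zero_iff.1 h2) (fun r x => by
        rw [map_smul_eq_mul, Real.norm_eq_abs]) (p := 1) one_pos
  simpa [Real.Gamma_nat_eq_factorial] using h

lemma exp_int_le (p : Seminorm ℝ (Fin n → ℝ)) {c : ℝ} (hc : 0 < c) (hp : ∀ x, c * ‖x‖ ≤ p x)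
    {a : ℝ} (ha : 0 < a) :
    ∫ y : Fin n → ℝ, exp (-a * p y) ≤ (n / a) ^ n * (volume {x | p x < 1}).toReal := by
  rw [exp_scale p ha, lt_one_vol p hc hp, ENNReal.toReal_ofReal (by positivity), div_pow,
    div_mul_div_comm, le_div_iff₀ (by positivity)]
  have h1 : (n.factorial : ℝ) ≤ (n : ℝ) ^ n := by exact_mod_cast Nat.factorial_le_pow n
  have hI : 0 ≤ ∫ x : Fin n → ℝ, exp (-p x) := integral_nonneg fun y => (exp_pos _).le
  have e : (a ^ n)⁻¹ * (∫ x : Fin n → ℝ, exp (-p x)) * (a ^ n * n.factorial) =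
    n.factorial * ∫ x : Fin n → ℝ, exp (-p x) := by field_simp
  rw [e]
  gcongr

/-- t |log t| bound -/
lemma abs_mul_log_le {t M : ℝ} (h0 : 0 ≤ t) (hM : t ≤ M) :
    |t * log t| ≤ 2 * √t + |log M| * t := by
  rcases h0.eq_or_lt with rfl | hpos
  · simp
  rcases le_total t 1 with h1 | h1
  · have hl : log t ≤ 0 := log_nonpos h0 h1
    rw [abs_of_nonpos (mul_nonpos_of_nonneg_of_nonpos h0 hl)]
    have hs : 0 < √t := by positivity
    have h2 := log_le_sub_one_of_pos (inv_pos.2 hs)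
    rw [log_inv, log_sqrt h0] at h2
    have h3 : √t * √t = t := mul_self_sqrt h0
    have h4 : -log t ≤ 2 * (√t)⁻¹ := by linarith
    have h5 : t * (√t)⁻¹ = √t := by
      nth_rw 1 [← h3]; field_simp
    have h6 := mul_le_mul_of_nonneg_left h4 h0
    have h7 : 0 ≤ |log M| * t := by positivity
    nlinarith
  · have hl : 0 ≤ log t := log_nonneg h1
    rw [abs_of_nonneg (by positivity)]
    have h2 : log t ≤ |log M| := (log_le_log hpos hM).trans (le_abs_self _)
    have : 0 ≤ √t := sqrt_nonneg t
    nlinarith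

theorem lc_main (hn : 1 ≤ n) {f : (Fin n → ℝ) → ℝ} (hlc : IsLogConcaveFn f) (hfm : Measurable f)
    (hf1 : ∫⁻ x, ENNReal.ofReal (f x) = 1) :
    ∃ (p : Seminorm ℝ (Fin n → ℝ)) (c : ℝ) (x0 : Fin n → ℝ) (M : ℝ),
      0 < c ∧ (∀ x, c * ‖x‖ ≤ p x) ∧ (∀ x, f x ≤ M) ∧
      Integrable (fun x => p (x - x0) * f x) ∧ ∫ x, p (x - x0) * f x ≤ 28 ∧
      volume (Ks p 1) ≤ ENNReal.ofReal ((8 * exp 2) ^ n * exp (shannonEntropy n f)) := by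
  have hf0 := hlc.1
  have hl := hlc.2
  have hn1 : (1 : ℝ) ≤ n := by exact_mod_cast hn
  have hfi : Integrable f := by
    refine ⟨hfm.aestronglyMeasurable, ?_⟩
    rw [hasFiniteIntegral_iff_ofReal (Filter.Eventually.of_forall hf0), hf1]
    exact ENNReal.one_lt_top
  have hfint : ∫ x, f x = 1 := by
    rw [integral_eq_lintegral_of_nonneg_ae (Filter.Eventually.of_forall hf0)
      hfm.aestronglyMeasurable, hf1]; rfl
  obtain ⟨M0, hM0⟩ := lc_bdd hlc hfm hf1
  obtain ⟨ε, hε, hA⟩ := pos_level hf1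
  -- near maximiser
  obtain ⟨x0, hm, hmax⟩ : ∃ x0, 0 < f x0 ∧ ∀ x, f x ≤ exp 1 * f x0 := by
    have hbdd : BddAbove (Set.range f) := ⟨M0, by rintro _ ⟨x, rfl⟩; exact hM0 x⟩
    have hAne : {x | ε ≤ f x}.Nonempty := nonempty_of_measure_ne_zero hA.ne'
    obtain ⟨z, hz⟩ := hAne
    have hz' : ε ≤ f z := hz
    have hs : 0 < ⨆ x, f x := lt_of_lt_of_le (lt_of_lt_of_le hε hz') (le_ciSup hbdd z)
    have he : 1 < exp 1 := by simp
    have hlt : (⨆ x, f x) / exp 1 < ⨆ x, f x := div_lt_self hs he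
    obtain ⟨x0, hx0⟩ := exists_lt_of_lt_ciSup hlt
    refine ⟨x0, lt_trans (by positivity) hx0, fun x => (le_ciSup hbdd x).trans ?_⟩
    rw [div_lt_iff₀ (exp_pos _)] at hx0
    linarith
  set m := f x0 with hmdef
  set K := {x | exp (-n) * m ≤ f x} with hK
  have hx0K : x0 ∈ K := by
    show exp (-n) * m ≤ m
    have : exp (-(n : ℝ)) ≤ 1 := exp_le_one_iff.2 (by linarith)
    nlinarith
  have hKm : MeasurableSet K := measurableSet_le measurable_const hfm
  have hlev : ∀ {δ : ℝ}, 0 < δ → Convex ℝ {x | δ ≤ f x} := by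
    intro δ hδ x hx y hy a b ha hb hab
    have hb' : b = 1 - a := by linarith
    subst hb'
    have h := hl x y a ha (by linarith)
    refine le_trans ?_ h
    have h1 : δ ^ a ≤ f x ^ a := Real.rpow_le_rpow hδ.le hx ha
    have h2 : δ ^ (1 - a) ≤ f y ^ (1 - a) := Real.rpow_le_rpow hδ.le hy hb
    calc δ = δ ^ a * δ ^ (1 - a) := by rw [← Real.rpow_add hδ]; simp
      _ ≤ _ := mul_le_mul h1 h2 (Real.rpow_nonneg hδ.le _) (Real.rpow_nonneg (hf0 x) _)
  have hKc : Convex ℝ K := hlev (by positivity)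
  have hKle : volume K ≤ ENNReal.ofReal (exp n / m) := by
    have h := markov hf0 hfm hf1 (exp (-n) * m)
    have e : ENNReal.ofReal (exp n / m) * ENNReal.ofReal (exp (-n) * m) = 1 := by
      rw [← ENNReal.ofReal_mul (by positivity), exp_neg]
      have : exp (n : ℝ) / m * ((exp n)⁻¹ * m) = 1 := by field_simp
      rw [this, ENNReal.ofReal_one]
    calc volume K = ENNReal.ofReal (exp n / m) * (ENNReal.ofReal (exp (-n) * m) * volume K) := by
          rw [← mul_assoc, e, one_mul]
      _ ≤ ENNReal.ofReal (exp n / m) * 1 := mul_le_mul' le_rfl h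
      _ = _ := mul_one _
  have hKtop : volume K ≠ ⊤ := ne_top_of_le_ne_top ENNReal.ofReal_ne_top hKle
  have hKpos : 0 < volume K := by
    -- shrink towards `x0`
    set t := 1 / (1 + |log (ε / m)|) with ht
    have htpos : 0 < t := by positivity
    have ht1 : t ≤ 1 := by
      rw [ht, div_le_one (by positivity)]; linarith [abs_nonneg (log (ε / m))]
    have h1 := vol_affine htpos ((1 - t) • x0) {x | ε ≤ f x} K (by
      intro a ha
      have h := hl a x0 t htpos.le ht1
      rw [add_comm] at h
      refine le_trans ?_ h
      have h2 : ε ^ t ≤ f a ^ t := Real.rpow_le_rpow hε.le ha htpos.le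
      refine le_trans ?_ (mul_le_mul_of_nonneg_right h2 (Real.rpow_nonneg hm.le _))
      rw [← hmdef, Real.rpow_sub hm, Real.rpow_one]
      have e : ε ^ t * (m / m ^ t) = (ε / m) ^ t * m := by
        rw [Real.div_rpow hε.le hm.le]; ring
      rw [e]
      gcongr
      rw [Real.rpow_def_of_pos (by positivity)]
      apply exp_le_exp.2
      have h3 := neg_abs_le (log (ε / m))
      have h4 : |log (ε / m)| * t ≤ 1 := by
        rw [ht, mul_one_div, div_le_one (by positivity)]; linarith
      nlinarith)
    refine lt_of_lt_of_le ?_ h1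
    refine pos_iff_ne_zero.2 (mul_ne_zero ?_ hA.ne')
    simpa using pow_pos htpos n
  obtain ⟨p, ⟨c, hc, hp⟩, hpK, hpvol⟩ := exists_gauge hn hKc hKm hKpos hKtop
  have hpc := seminorm_cont p
  -- decay
  have hdecay : ∀ x, f x ≤ exp (2 * n) * m * exp (-(n / 2) * p (x - x0)) := by
    intro x
    rcases le_or_gt (p (x - x0)) 2 with h | h
    · refine (hmax x).trans ?_
      have h1 : exp 1 ≤ exp (2 * n) * exp (-(n / 2) * p (x - x0)) := by
        rw [← exp_add]
        apply exp_le_exp.2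
        nlinarith
      nlinarith
    · set q := p (x - x0) with hq
      have hq0 : 0 < q := by linarith
      set z := (2 / q) • x + (1 - 2 / q) • x0 with hz
      have hz0 : z - x0 = (2 / q) • (x - x0) := by rw [hz]; module
      have hpz : p (z - x0) = 2 := by
        rw [hz0, map_smul_eq_mul, Real.norm_of_nonneg (by positivity), ← hq]; field_simp
      have hzK : z ∉ K := by
        intro hzK
        have := hpK z hzK x0 hx0K
        rw [hpz] at this
        norm_num at this
      have hfz : f z < exp (-n) * m := by simpa [hK] using hzK
      have h2q : 2 / q ≤ 1 := by rw [div_le_one hq0]; exact h.le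
      have h1 := (hl x x0 (2 / q) (by positivity) h2q).trans_lt hfz
      have h2 : f x ^ (2 / q) ≤ exp (-n) * m ^ (2 / q) := by
        rw [← hmdef, Real.rpow_sub hm, Real.rpow_one] at h1
        have hmq : 0 < m ^ (2 / q) := Real.rpow_pos_of_pos hm _
        rw [← mul_div_assoc, div_lt_iff₀ hmq] at h1
        have : f x ^ (2 / q) * m < (exp (-n) * m ^ (2 / q)) * m := by linarith
        exact (lt_of_mul_lt_mul_right this hm.le).le
      have h3 := Real.rpow_le_rpow (Real.rpow_nonneg (hf0 x) _) h2 (z := q / 2) (by positivity)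
      have e : 2 / q * (q / 2) = 1 := by field_simp
      rw [Real.mul_rpow (exp_pos _).le (Real.rpow_nonneg hm.le _), ← Real.rpow_mul (hf0 x),
        ← Real.rpow_mul hm.le, e, Real.rpow_one, Real.rpow_one, ← Real.exp_mul] at h3
      have h4 : 1 ≤ exp (2 * (n : ℝ)) := one_le_exp (by positivity)
      have e2 : -(n : ℝ) * (q / 2) = -(n / 2) * q := by ring
      rw [e2] at h3
      refine h3.trans ?_
      have h5 : 0 ≤ exp (-(n / 2 : ℝ) * q) * m := by positivity
      nlinarith
  -- entropy
  have hfl : Integrable (fun x => f x * log (f x)) := by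
    have hs : Integrable (fun x => √(f x)) := by
      have hi := ((int_exp_neg p hc hp (a := n / 4) (by positivity)).comp_sub_right x0).const_mul
        (√(exp (2 * n) * m))
      refine hi.mono' (hfm.sqrt).aestronglyMeasurable (Filter.Eventually.of_forall fun x => ?_)
      rw [Real.norm_of_nonneg (sqrt_nonneg _)]
      refine (sqrt_le_sqrt (hdecay x)).trans (le_of_eq ?_)
      rw [sqrt_mul (by positivity)]
      congr 1
      rw [← exp_half]
      congr 1; ring
    refine ((hs.const_mul 2).add (hfi.const_mul |log (exp 1 * m)|)).mono'
      (hfm.mul hfm.log).aestronglyMeasurable (Filter.Eventually.of_forall fun x => ?_)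
    exact abs_mul_log_le (hf0 x) (hmax x)
  have hent : -(1 + log m) ≤ shannonEntropy n f := by
    rw [shannonEntropy, neg_le_neg_iff]
    calc ∫ x, f x * log (f x) ≤ ∫ x, f x * (1 + log m) := by
          refine integral_mono hfl (hfi.mul_const _) fun x => ?_
          simp only
          rcases (hf0 x).eq_or_lt with h | h
          · rw [← h]; simp
          · gcongr
            have := log_le_log h (hmax x)
            rwa [log_mul (exp_pos _).ne' hm.ne', log_exp] at this
      _ = 1 + log m := by rw [integral_mul_const, hfint, one_mul]
  have hKvol : volume (Ks p 1) ≤ ENNReal.ofReal (8 ^ n * (exp n / m)) := by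
    rw [ENNReal.ofReal_mul (by positivity)]
    exact hpvol.trans (mul_le_mul' le_rfl hKle)
  -- first moment
  have hlt : (volume {x | p x < 1}).toReal ≤ 8 ^ n * (exp n / m) := by
    refine ENNReal.toReal_le_of_le_ofReal (by positivity) (le_trans (measure_mono ?_) hKvol)
    intro x (hx : p x < 1)
    exact hx.le
  have i4 := (int_exp_neg p hc hp (a := n / 4) (by positivity)).comp_sub_right x0
  have hE : ∫ x, exp (-(n / 4) * p (x - x0)) ≤ 4 ^ n * (8 ^ n * (exp n / m)) := by
    rw [integral_sub_right_eq_self (fun x => exp (-(n / 4) * p x)) x0]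
    refine (exp_int_le p hc hp (a := n / 4) (by positivity)).trans ?_
    have e : (n : ℝ) / (n / 4) = 4 := by field_simp
    rw [e]
    gcongr
  have hpt : ∀ x, p (x - x0) * f x ≤ (4 / n) * (exp (-(7 * n)) * (exp (2 * n) * m) *
      exp (-(n / 4) * p (x - x0)) + (7 * n - 1) * f x) := by
    intro x
    set q := p (x - x0)
    have h1 := add_one_le_exp (n / 4 * q - 7 * n)
    have h2 : f x * exp (n / 4 * q - 7 * n) ≤ exp (-(7 * n)) * (exp (2 * n) * m) * exp (-(n / 4) * q) := by
      calc f x * exp (n / 4 * q - 7 * n)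
          ≤ (exp (2 * n) * m * exp (-(n / 2) * q)) * exp (n / 4 * q - 7 * n) := by
            gcongr
            exact hdecay x
        _ = exp (2 * n) * m * exp ((-(n / 2) * q) + (n / 4 * q - 7 * n)) := by
            rw [exp_add]; ring
        _ = exp (2 * n) * m * exp (-(7 * n) + (-(n / 4) * q)) := by congr 2; ring
        _ = _ := by rw [exp_add]; ring
    have h3 := mul_le_mul_of_nonneg_left h1 (hf0 x)
    have e : q * f x = 4 / n * (f x * (n / 4 * q)) := by field_simp
    rw [e]
    gcongr
    linarith
  have hib : Integrable (fun x => (4 / n) * (exp (-(7 * n)) * (exp (2 * n) * m) *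
      exp (-(n / 4) * p (x - x0)) + (7 * n - 1) * f x)) :=
    ((i4.const_mul _).add (hfi.const_mul _)).const_mul _
  have hpi : Integrable (fun x => p (x - x0) * f x) := by
    refine hib.mono' (Measurable.aestronglyMeasurable ?_) (Filter.Eventually.of_forall fun x => ?_)
    · exact (Continuous.measurable (by fun_prop)).mul hfm
    · rw [Real.norm_of_nonneg (mul_nonneg (apply_nonneg _ _) (hf0 x))]
      exact hpt x
  have hmom : ∫ x, p (x - x0) * f x ≤ 28 := by
    refine (integral_mono hpi hib hpt).trans ?_
    rw [integral_const_mul, integral_add (i4.const_mul _) (hfi.const_mul _), integral_const_mul,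
      integral_const_mul, hfint]
    have h32 : (4 : ℝ) ^ n * 8 ^ n ≤ exp (4 * n) := by
      rw [← mul_pow, mul_comm (4 : ℝ) (n : ℝ), exp_nat_mul]
      gcongr
      have := exp_one_gt_d9
      have e : exp 4 = exp 1 ^ 4 := by rw [← exp_nat_mul]; norm_num
      rw [e]
      calc (4 * 8 : ℝ) ≤ 2.7 ^ 4 := by norm_num
        _ ≤ _ := by gcongr; linarith
    have h1 : exp (-(7 * n)) * (exp (2 * n) * m) * ∫ x, exp (-(n / 4) * p (x - x0)) ≤ 1 := by
      calc exp (-(7 * n)) * (exp (2 * n) * m) * ∫ x, exp (-(n / 4) * p (x - x0))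
          ≤ exp (-(7 * n)) * (exp (2 * n) * m) * (4 ^ n * (8 ^ n * (exp n / m))) := by gcongr
        _ = exp (-(7 * n)) * exp (2 * n) * exp n * (4 ^ n * 8 ^ n) := by field_simp
        _ ≤ exp (-(7 * n)) * exp (2 * n) * exp n * exp (4 * n) := by gcongr
        _ = exp (-(7 * n) + 2 * n + n + 4 * n) := by rw [exp_add, exp_add, exp_add]
        _ = 1 := by ring_nf; exact exp_zero
    calc 4 / (n : ℝ) * ((exp (-(7 * n)) * (exp (2 * n) * m) * ∫ x, exp (-(n / 4) * p (x - x0)))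
          + (7 * n - 1) * 1) ≤ 4 / n * (1 + (7 * n - 1) * 1) := by gcongr
      _ = 28 := by field_simp; ring
  refine ⟨p, c, x0, exp 1 * m, hc, hp, hmax, hpi, hmom, hKvol.trans ?_⟩
  apply ENNReal.ofReal_le_ofReal
  have h1 : exp (-(1 + log m)) ≤ exp (shannonEntropy n f) := exp_le_exp.2 hent
  have h2 : exp (-(1 + log m)) = exp (-1) / m := by
    rw [neg_add, exp_add, exp_neg (log m), exp_log hm, div_eq_mul_inv]
  rw [h2] at h1
  have h3 : exp (n : ℝ) ≤ exp 2 ^ n * exp (-1) := by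
    rw [← exp_nat_mul, ← exp_add]
    apply exp_le_exp.2
    linarith
  calc 8 ^ n * (exp n / m) ≤ 8 ^ n * ((exp 2 ^ n * exp (-1)) / m) := by gcongr
    _ = (8 * exp 2) ^ n * (exp (-1) / m) := by rw [mul_pow]; ring
    _ ≤ _ := by gcongr

end REPI

namespace REPI

lemma sum_norm {n : ℕ} {u1 u2 : (Fin n → ℝ) →ₗ[ℝ] (Fin n → ℝ)} (hu1 : LinearMap.det u1 = 1)
    (hu2 : LinearMap.det u2 = 1) {p1 p2 : Seminorm ℝ (Fin n → ℝ)} {c1 c2 : ℝ} (hc1 : 0 < c1)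
    (hc2 : 0 < c2) (hp1 : ∀ x, c1 * ‖x‖ ≤ p1 x) (hp2 : ∀ x, c2 * ‖x‖ ≤ p2 x) :
    ∃ p : Seminorm ℝ (Fin n → ℝ), ∃ c : ℝ, 0 < c ∧ (∀ z, c * ‖z‖ ≤ p z) ∧
      (∀ x y, p (u1 x + u2 y) ≤ p1 x + p2 y) ∧
      (∀ z, p z < 1 → ∃ a b, z = u1 a + u2 b ∧ p1 a ≤ 1 ∧ p2 b ≤ 1) := by
  let e1 := LinearMap.equivOfDetNeZero u1 (by rw [hu1]; exact one_ne_zero)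
  let e2 := LinearMap.equivOfDetNeZero u2 (by rw [hu2]; exact one_ne_zero)
  have he1 : ∀ x, e1 x = u1 x := fun x => rfl
  have he2 : ∀ x, e2 x = u2 x := fun x => rfl
  let q1 : Seminorm ℝ (Fin n → ℝ) := p1.comp e1.symm.toLinearMap
  let q2 : Seminorm ℝ (Fin n → ℝ) := p2.comp e2.symm.toLinearMap
  have hq1 : ∀ z, q1 z = p1 (e1.symm z) := fun z => rfl
  have hq2 : ∀ z, q2 z = p2 (e2.symm z) := fun z => rfl
  have hbd : ∀ z, BddBelow (Set.range fun u => q1 u + q2 (z - u)) := fun z =>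
    ⟨0, by rintro _ ⟨u, rfl⟩; exact add_nonneg (apply_nonneg _ _) (apply_nonneg _ _)⟩
  have key : ∀ (u : (Fin n → ℝ) →ₗ[ℝ] (Fin n → ℝ)), ∃ C : ℝ, 0 < C ∧ ∀ x, ‖u x‖ ≤ C * ‖x‖ := by
    intro u
    refine ⟨‖LinearMap.toContinuousLinearMap u‖ + 1, by positivity, fun x => ?_⟩
    have := (LinearMap.toContinuousLinearMap u).le_opNorm x
    have h2 := norm_nonneg x
    simp only [LinearMap.coe_toContinuousLinearMap'] at this
    linarith
  obtain ⟨C1, hC1, hk1⟩ := key u1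
  obtain ⟨C2, hC2, hk2⟩ := key u2
  refine ⟨q1 ⊓ q2, min (c1 / C1) (c2 / C2), by positivity, fun z => ?_, fun x y => ?_, fun z hz => ?_⟩
  · rw [Seminorm.inf_apply]
    apply le_ciInf
    intro u
    have h1 : (c1 / C1) * ‖u‖ ≤ q1 u := by
      rw [hq1]
      refine le_trans ?_ (hp1 _)
      have := hk1 (e1.symm u)
      rw [← he1, LinearEquiv.apply_symm_apply] at this
      rw [div_mul_eq_mul_div, div_le_iff₀ hC1]
      nlinarith
    have h2 : (c2 / C2) * ‖z - u‖ ≤ q2 (z - u) := by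
      rw [hq2]
      refine le_trans ?_ (hp2 _)
      have := hk2 (e2.symm (z - u))
      rw [← he2, LinearEquiv.apply_symm_apply] at this
      rw [div_mul_eq_mul_div, div_le_iff₀ hC2]
      nlinarith
    have h3 : ‖z‖ ≤ ‖u‖ + ‖z - u‖ := by
      have := norm_add_le u (z - u)
      rwa [add_sub_cancel] at this
    have h0 : 0 < min (c1 / C1) (c2 / C2) := by positivity
    calc _ ≤ min (c1 / C1) (c2 / C2) * (‖u‖ + ‖z - u‖) := by gcongr
      _ ≤ (c1 / C1) * ‖u‖ + (c2 / C2) * ‖z - u‖ := by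
        rw [mul_add]
        gcongr
        · exact min_le_left _ _
        · exact min_le_right _ _
      _ ≤ _ := add_le_add h1 h2
  · rw [Seminorm.inf_apply]
    refine (ciInf_le (hbd _) (u1 x)).trans ?_
    rw [hq1, hq2, add_sub_cancel_left, ← he1, ← he2, LinearEquiv.symm_apply_apply,
      LinearEquiv.symm_apply_apply]
  · rw [Seminorm.inf_apply] at hz
    obtain ⟨u, hu⟩ := exists_lt_of_ciInf_lt hz
    have h1 := apply_nonneg q1 u
    have h2 := apply_nonneg q2 (z - u)
    refine ⟨e1.symm u, e2.symm (z - u), ?_, ?_, ?_⟩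
    · rw [← he1, ← he2]; simp
    · rw [← hq1]; linarith
    · rw [← hq2]; linarith

lemma Cov_sum {n : ℕ} {S A1 A2 : Set (Fin n → ℝ)} {r1 r2 m1 m2 : ℝ}
    (h1 : Cov A1 (Bs n r1) m1) (h2 : Cov A2 (Bs n r2) m2)
    (hS : ∀ z ∈ S, ∃ a ∈ A1, ∃ b ∈ A2, z = a + b) :
    Cov S (Bs n (√(2 * (r1 ^ 2 + r2 ^ 2)))) (m1 * m2) := by
  classical
  obtain ⟨s1, hs1, hA1⟩ := h1
  obtain ⟨s2, hs2, hA2⟩ := h2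
  refine ⟨(s1 ×ˢ s2).image fun q => q.1 + q.2, ?_, ?_⟩
  · have h : ((s1 ×ˢ s2).image fun q => q.1 + q.2).card ≤ s1.card * s2.card :=
      Finset.card_image_le.trans (Finset.card_product _ _).le
    have h' : (((s1 ×ˢ s2).image fun q => q.1 + q.2).card : ℝ) ≤ s1.card * s2.card := by
      exact_mod_cast h
    refine h'.trans ?_
    have : (0 : ℝ) ≤ s1.card := by positivity
    gcongr
    linarith
  · intro z hz
    obtain ⟨a, ha, b, hb, rfl⟩ := hS z hz
    obtain ⟨x, hx, hax⟩ := hA1 a ha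
    obtain ⟨y, hy, hby⟩ := hA2 b hb
    refine ⟨x + y, Finset.mem_image.2 ⟨(x, y), Finset.mk_mem_product hx hy, rfl⟩, ?_⟩
    simp only [Bs, Set.mem_ofPred_eq] at hax hby ⊢
    rw [Real.sq_sqrt (by positivity), add_sub_add_comm]
    set v := a - x
    set w := b - y
    have e : (v + w) ⬝ᵥ (v + w) + (v - w) ⬝ᵥ (v - w) = 2 * (v ⬝ᵥ v + w ⬝ᵥ w) := by
      simp only [add_dotProduct, dotProduct_add, sub_dotProduct, dotProduct_sub]; ring
    have := dotProduct_self_star_nonneg (v - w)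
    simp only [star_trivial] at this
    linarith

lemma W_vol {n : ℕ} {u1 u2 : (Fin n → ℝ) →ₗ[ℝ] (Fin n → ℝ)} {p p1 p2 : Seminorm ℝ (Fin n → ℝ)}
    {r1 r2 : ℝ}
    (h1 : Cov (u1 '' Ks p1 1) (Bs n r1) (exp (12 * n)))
    (h2 : Cov (u2 '' Ks p2 1) (Bs n r2) (exp (12 * n)))
    (hS : ∀ z, p z < 1 → ∃ a b, z = u1 a + u2 b ∧ p1 a ≤ 1 ∧ p2 b ≤ 1) :
    volume {z | p z < 1} ≤ ENNReal.ofReal (exp (24 * n)) *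
      volume (Bs n (√(2 * (r1 ^ 2 + r2 ^ 2)))) := by
  have h := Cov_sum (S := {z | p z < 1}) h1 h2 (fun z hz => by
    obtain ⟨a, b, e, ha, hb⟩ := hS z hz
    exact ⟨u1 a, ⟨a, ha, rfl⟩, u2 b, ⟨b, hb, rfl⟩, e⟩)
  have := Cov.volume_le h
  rw [← exp_add] at this
  convert this using 4
  ring

/-- Gibbs -/
lemma gibbs {n : ℕ} (hn : 1 ≤ n) (p : Seminorm ℝ (Fin n → ℝ)) {c : ℝ} (hc : 0 < c)
    (hp : ∀ x, c * ‖x‖ ≤ p x) {h : (Fin n → ℝ) → ℝ} (hm : Measurable h) (h0 : ∀ x, 0 ≤ h x)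
    (h1 : ∫⁻ x, ENNReal.ofReal (h x) = 1) {M : ℝ} (hM : ∀ᵐ x, h x ≤ M) (z0 : Fin n → ℝ)
    {B : ℝ} (hI : Integrable (fun z => p (z - z0) * h z)) (hB : ∫ z, p (z - z0) * h z ≤ B) :
    shannonEntropy n h ≤ log (volume {z | p z < 1}).toReal + B * n := by
  have hn0 : (0 : ℝ) < n := by exact_mod_cast hn
  have hhI : Integrable h := by
    refine ⟨hm.aestronglyMeasurable, ?_⟩
    rw [hasFiniteIntegral_iff_ofReal (Filter.Eventually.of_forall h0), h1]
    exact ENNReal.one_lt_top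
  have hhI1 : ∫ x, h x = 1 := by
    rw [integral_eq_lintegral_of_nonneg_ae (Filter.Eventually.of_forall h0) hm.aestronglyMeasurable,
      h1]
    rfl
  have hi := int_exp_neg p hc hp hn0
  set A := ∫ y : Fin n → ℝ, exp (-n * p y) with hA
  have hApos : 0 < A := integral_exp_pos hi
  have hAle : A ≤ (volume {z | p z < 1}).toReal := by
    have := exp_int_le p hc hp hn0
    rwa [div_self hn0.ne', one_pow, one_mul] at this
  have hi' : Integrable (fun z => exp (-n * p (z - z0))) := hi.comp_sub_right z0
  have hA' : ∫ z, exp (-n * p (z - z0)) = A := integral_sub_right_eq_self (fun z => exp (-n * p z)) z0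
  -- pointwise
  have hpt : ∀ z, -(n * (p (z - z0) * h z)) - log A * h z + h z - exp (-n * p (z - z0)) / A
      ≤ h z * log (h z) := by
    intro z
    rcases (h0 z).eq_or_lt with e | hpos
    · rw [← e]; simp; positivity
    · set w := exp (-n * p (z - z0)) / A with hw
      have hwpos : 0 < w := by positivity
      have hlw : log w = -n * p (z - z0) - log A := by
        rw [hw, log_div (exp_pos _).ne' hApos.ne', log_exp]
      have := log_le_sub_one_of_pos (div_pos hwpos hpos)
      rw [log_div hwpos.ne' hpos.ne', hlw] at this
      have h2 := mul_le_mul_of_nonneg_left this hpos.le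
      have h3 : h z * (w / h z - 1) = w - h z := by field_simp
      rw [h3] at h2
      nlinarith
  have hiL : Integrable (fun z => -(n * (p (z - z0) * h z)) - log A * h z + h z
      - exp (-n * p (z - z0)) / A) :=
    ((((hI.const_mul (n : ℝ)).neg).sub (hhI.const_mul _)).add hhI).sub (hi'.div_const _)
  have hhl : Integrable (fun z => h z * log (h z)) := by
    have hdom := hiL.abs.add (hhI.const_mul |log M|)
    refine hdom.mono' (hm.mul (measurable_log.comp hm)).aestronglyMeasurable ?_
    filter_upwards [hM] with z hz
    have hL := hpt z
    have hU : h z * log (h z) ≤ |log M| * h z := by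
      rcases (h0 z).eq_or_lt with e | hpos
      · rw [← e]; simp
      · rw [mul_comm]
        gcongr
        exact (log_le_log hpos hz).trans (le_abs_self _)
    have h5 : 0 ≤ |log M| * h z := mul_nonneg (abs_nonneg _) (h0 z)
    simp only [Pi.add_apply]
    rw [Real.norm_eq_abs, abs_le]
    constructor
    · have := neg_abs_le (-(n * (p (z - z0) * h z)) - log A * h z + h z
        - exp (-n * p (z - z0)) / A)
      linarith
    · have := abs_nonneg (-(n * (p (z - z0) * h z)) - log A * h z + h z
        - exp (-n * p (z - z0)) / A)
      linarith
  have hmono := integral_mono hiL hhl hpt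
  have hcomp : ∫ z, (-(n * (p (z - z0) * h z)) - log A * h z + h z - exp (-n * p (z - z0)) / A)
      = -(n * ∫ z, p (z - z0) * h z) - log A := by
    have a1 : Integrable (fun z => -(n * (p (z - z0) * h z))) := (hI.const_mul (n : ℝ)).neg
    have a2 : Integrable (fun z => log A * h z) := hhI.const_mul _
    have a3 : Integrable (fun z => -(n * (p (z - z0) * h z)) - log A * h z) := a1.sub a2
    have a4 : Integrable (fun z => -(n * (p (z - z0) * h z)) - log A * h z + h z) := a3.add hhI
    have a5 : Integrable (fun z => exp (-n * p (z - z0)) / A) := hi'.div_const _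
    rw [integral_sub a4 a5, integral_add a3 hhI, integral_sub a1 a2, integral_neg,
      integral_const_mul, integral_const_mul, integral_div, hA', hhI1, div_self hApos.ne']
    ring
  rw [hcomp] at hmono
  unfold shannonEntropy
  have := log_le_log hApos hAle
  nlinarith

end REPI

namespace REPI

lemma dens_one {Ω : Type*} [MeasurableSpace Ω] {n : ℕ} {P : Measure Ω} [IsProbabilityMeasure P]
    {X : Ω → (Fin n → ℝ)} {f : (Fin n → ℝ) → ℝ} (h : HasDensityFn P X f) :
    ∫⁻ x, ENNReal.ofReal (f x) = 1 := by
  obtain ⟨hX, hf, h0, hm⟩ := h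
  have := Measure.isProbabilityMeasure_map (μ := P) hX.aemeasurable
  have h1 : (Measure.map X P) Set.univ = 1 := measure_univ
  rw [hm, withDensity_apply _ MeasurableSet.univ, Measure.restrict_univ] at h1
  exact h1

lemma dens_integrable {Ω : Type*} [MeasurableSpace Ω] {n : ℕ} {P : Measure Ω}
    {X : Ω → (Fin n → ℝ)} {f : (Fin n → ℝ) → ℝ} (h : HasDensityFn P X f) {φ : (Fin n → ℝ) → ℝ}
    (hφ : Measurable φ) :
    Integrable (fun ω => φ (X ω)) P ↔ Integrable (fun x => φ x * f x) := by
  obtain ⟨hX, hf, h0, hm⟩ := h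
  have h1 := integrable_map_measure (μ := P) (f := X) (g := φ) hφ.aestronglyMeasurable
    hX.aemeasurable
  rw [hm, integrable_withDensity_iff_integrable_smul' hf.ennreal_ofReal
    (Filter.Eventually.of_forall fun x => ENNReal.ofReal_lt_top)] at h1
  rw [show (fun ω => φ (X ω)) = φ ∘ X from rfl, ← h1]
  apply integrable_congr (Filter.Eventually.of_forall fun x => ?_)
  simp only [ENNReal.toReal_ofReal (h0 x), smul_eq_mul, mul_comm]

lemma dens_integral {Ω : Type*} [MeasurableSpace Ω] {n : ℕ} {P : Measure Ω}
    {X : Ω → (Fin n → ℝ)} {f : (Fin n → ℝ) → ℝ} (h : HasDensityFn P X f) {φ : (Fin n → ℝ) → ℝ}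
    (hφ : Measurable φ) :
    ∫ ω, φ (X ω) ∂P = ∫ x, φ x * f x := by
  obtain ⟨hX, hf, h0, hm⟩ := h
  rw [← integral_map hX.aemeasurable hφ.aestronglyMeasurable, hm,
    integral_withDensity_eq_integral_toReal_smul hf.ennreal_ofReal
    (Filter.Eventually.of_forall fun x => ENNReal.ofReal_lt_top)]
  congr 1
  ext x
  simp only [ENNReal.toReal_ofReal (h0 x), smul_eq_mul, mul_comm]

lemma lin_meas {n : ℕ} (u : (Fin n → ℝ) →ₗ[ℝ] (Fin n → ℝ)) : Measurable u :=
  (LinearMap.continuous_of_finiteDimensional u).measurable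

lemma dens_bound {Ω : Type*} [MeasurableSpace Ω] {n : ℕ} {P : Measure Ω} [IsProbabilityMeasure P]
    {X Y : Ω → (Fin n → ℝ)} {f h : (Fin n → ℝ) → ℝ} (hX : HasDensityFn P X f) (hY : Measurable Y)
    (hXY : IndepFun X Y P) {u1 u2 : (Fin n → ℝ) →ₗ[ℝ] (Fin n → ℝ)} (hu1 : LinearMap.det u1 = 1)
    (hZ : HasDensityFn P (fun ω => u1 (X ω) + u2 (Y ω)) h) {M : ℝ} (hM : ∀ x, f x ≤ M) :
    ∀ᵐ x, h x ≤ M := by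
  have hXm := hX.1
  have hM0 : 0 ≤ M := (hX.2.2.1 0).trans (hM 0)
  have hprod := (indepFun_iff_map_prod_eq_prod_map_map hXm.aemeasurable hY.aemeasurable).1 hXY
  have pX := Measure.isProbabilityMeasure_map (μ := P) hXm.aemeasurable
  have pY := Measure.isProbabilityMeasure_map (μ := P) hY.aemeasurable
  have key : (fun x => ENNReal.ofReal (h x)) ≤ᵐ[volume] fun _ => ENNReal.ofReal M := by
    refine ae_le_of_forall_setLIntegral_le_of_sigmaFinite hZ.2.1.ennreal_ofReal
      fun S hS _ => ?_
    rw [← withDensity_apply _ hS, ← hZ.2.2.2, setLIntegral_const]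
    let T : (Fin n → ℝ) × (Fin n → ℝ) → (Fin n → ℝ) := fun q => u1 q.1 + u2 q.2
    have hT : Measurable T := ((lin_meas u1).comp measurable_fst).add
      ((lin_meas u2).comp measurable_snd)
    have e : Measure.map (fun ω => u1 (X ω) + u2 (Y ω)) P =
        Measure.map T ((Measure.map X P).prod (Measure.map Y P)) := by
      rw [← hprod, Measure.map_map hT (hXm.prodMk hY)]
      rfl
    rw [e, Measure.map_apply hT hS, Measure.prod_apply_symm (hT hS)]
    have hb : ∀ y, (Measure.map X P) ((fun x => (x, y)) ⁻¹' (T ⁻¹' S)) ≤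
        ENNReal.ofReal M * volume S := by
      intro y
      have hms : MeasurableSet ((fun x => (x, y)) ⁻¹' (T ⁻¹' S)) :=
        measurable_prodMk_right (hT hS)
      rw [hX.2.2.2, withDensity_apply _ hms]
      calc _ ≤ ∫⁻ x in ((fun x => (x, y)) ⁻¹' (T ⁻¹' S)), ENNReal.ofReal M :=
            lintegral_mono fun x => ENNReal.ofReal_le_ofReal (hM x)
        _ = ENNReal.ofReal M * volume ((fun x => (x, y)) ⁻¹' (T ⁻¹' S)) := setLIntegral_const _ _
        _ = ENNReal.ofReal M * volume S := by
            congr 1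
            have : ((fun x => (x, y)) ⁻¹' (T ⁻¹' S)) = u1 ⁻¹' ((fun z => z + u2 y) ⁻¹' S) := rfl
            rw [this, Measure.addHaar_preimage_linearMap _ (by rw [hu1]; exact one_ne_zero), hu1]
            simp
    calc _ ≤ ∫⁻ _, ENNReal.ofReal M * volume S ∂(Measure.map Y P) := lintegral_mono hb
      _ = _ := by simp
  filter_upwards [key] with x hx
  exact (ENNReal.ofReal_le_ofReal_iff hM0).1 hx

theorem final {Ω : Type*} [MeasurableSpace Ω] {n : ℕ} (hn : 1 ≤ n) {P : Measure Ω}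
    [IsProbabilityMeasure P] {X Y : Ω → (Fin n → ℝ)} {f g : (Fin n → ℝ) → ℝ}
    (hX : HasDensityFn P X f) (hY : HasDensityFn P Y g) (hf : IsLogConcaveFn f)
    (hg : IsLogConcaveFn g) (hXY : IndepFun X Y P) :
    ∃ u₁ u₂ : (Fin n → ℝ) →ₗ[ℝ] (Fin n → ℝ),
      LinearMap.det u₁ = 1 ∧ LinearMap.det u₂ = 1 ∧
      ∀ h : (Fin n → ℝ) → ℝ, HasDensityFn P (fun ω => u₁ (X ω) + u₂ (Y ω)) h →
        entropyPower n h ≤ (exp 160 * 2 * ((64 * exp 72) * (8 * exp 2)) ^ 2) *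
          (entropyPower n f + entropyPower n g) := by
  have hn0 : (0 : ℝ) < n := by exact_mod_cast hn
  obtain ⟨p1, c1, x0, M, hc1, hp1, hM, hI1, hE1, hv1⟩ := lc_main hn hf hX.2.1 (dens_one hX)
  obtain ⟨p2, c2, y0, -, hc2, hp2, -, hI2, hE2, hv2⟩ := lc_main hn hg hY.2.1 (dens_one hY)
  obtain ⟨u1, hu1, r1, hr1, hcov1, hvol1⟩ := M_position hn p1 hc1 hp1
  obtain ⟨u2, hu2, r2, hr2, hcov2, hvol2⟩ := M_position hn p2 hc2 hp2
  refine ⟨u1, u2, hu1, hu2, fun h hZ => ?_⟩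
  obtain ⟨p, c, hc, hp, hsub, hdec⟩ := sum_norm hu1 hu2 hc1 hc2 hp1 hp2
  have hk := W_vol hcov1 hcov2 hdec
  have hbd := dens_bound hX hY.1 hXY hu1 hZ hM
  set z0 := u1 x0 + u2 y0 with hz0
  have m : ∀ (q : Seminorm ℝ (Fin n → ℝ)) (w : Fin n → ℝ), Measurable fun x => q (x - w) := by
    intro q w
    have := seminorm_cont q
    exact Continuous.measurable (by fun_prop)
  have j1 := (dens_integrable hX (m p1 x0)).2 hI1
  have j2 := (dens_integrable hY (m p2 y0)).2 hI2
  have hle : ∀ ω, p (u1 (X ω) + u2 (Y ω) - z0) ≤ p1 (X ω - x0) + p2 (Y ω - y0) := by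
    intro ω
    have := hsub (X ω - x0) (Y ω - y0)
    rw [map_sub, map_sub] at this
    rwa [hz0, add_sub_add_comm]
  have j : Integrable (fun ω => p (u1 (X ω) + u2 (Y ω) - z0)) P := by
    refine (j1.add j2).mono' ((m p z0).comp hZ.1).aestronglyMeasurable
      (Filter.Eventually.of_forall fun ω => ?_)
    rw [Real.norm_of_nonneg (apply_nonneg _ _)]
    exact hle ω
  have hI := (dens_integrable hZ (m p z0)).1 j
  have hB : ∫ z, p (z - z0) * h z ≤ 56 := by
    rw [← dens_integral hZ (m p z0)]
    refine (integral_mono j (j1.add j2) hle).trans ?_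
    rw [integral_add' j1 j2, dens_integral hX (m p1 x0), dens_integral hY (m p2 y0)]
    linarith
  have hG := gibbs hn p hc hp hZ.2.1 hZ.2.2.1 (dens_one hZ) hbd z0 hI hB
  -- numerics
  set ρ := √(2 * (r1 ^ 2 + r2 ^ 2)) with hρ
  have hρpos : 0 < ρ := by positivity
  have hρ2 : ρ ^ 2 = 2 * (r1 ^ 2 + r2 ^ 2) := Real.sq_sqrt (by positivity)
  have hKtop : ∀ (q : Seminorm ℝ (Fin n → ℝ)) {c : ℝ}, 0 < c → (∀ x, c * ‖x‖ ≤ q x) →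
    volume (Ks q 1) < ⊤ := fun q c h1 h2 => Ks_vol_lt_top q h1 h2 1
  have hBtop : volume (Bs n 1) ≠ ⊤ := by
    have h1 : volume (Bs n r1) < ⊤ := hvol1.trans_lt (ENNReal.mul_lt_top ENNReal.ofReal_lt_top
      (hKtop p1 hc1 hp1))
    rw [vol_Bs hr1] at h1
    intro e
    rw [e, ENNReal.mul_top (by simp; positivity)] at h1
    exact lt_irrefl _ h1
  set b := (volume (Bs n 1)).toReal with hb
  have hkpos : 0 < (volume {z | p z < 1}).toReal := by
    refine lt_of_lt_of_le ?_ (le_trans (exp_int_le p hc hp hn0) ?_)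
    · exact integral_exp_pos (int_exp_neg p hc hp hn0)
    · rw [div_self hn0.ne', one_pow, one_mul]
  have hk' : (volume {z | p z < 1}).toReal ≤ exp (24 * n) * (ρ ^ n * b) := by
    rw [vol_Bs hρpos] at hk
    have := ENNReal.toReal_mono (ENNReal.mul_ne_top ENNReal.ofReal_ne_top
      (ENNReal.mul_ne_top ENNReal.ofReal_ne_top hBtop)) hk
    rwa [ENNReal.toReal_mul, ENNReal.toReal_mul, ENNReal.toReal_ofReal (by positivity),
      ENNReal.toReal_ofReal (by positivity)] at this
  have hbpos : 0 < b := by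
    have h1 : 0 < exp (24 * n) * (ρ ^ n * b) := hkpos.trans_le hk'
    have h2 : 0 < ρ ^ n * b := pos_of_mul_pos_right h1 (exp_pos _).le
    exact pos_of_mul_pos_right h2 (by positivity)
  set D := (64 * exp 72) * (8 * exp 2) with hD
  have hDpos : 0 < D := by positivity
  have hr : ∀ (r s : ℝ) (v : ENNReal), 0 < r →
      volume (Bs n r) ≤ ENNReal.ofReal ((64 * exp 72) ^ n) * v →
      v ≤ ENNReal.ofReal ((8 * exp 2) ^ n * exp s) →
      r ^ 2 * exp (2 * log b / n) ≤ D ^ 2 * exp (2 * s / n) := by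
    intro r s v hr h1 h2
    have h3 := h1.trans (mul_le_mul_right h2 _)
    rw [vol_Bs hr, ← ENNReal.ofReal_toReal hBtop, ← hb, ← ENNReal.ofReal_mul (by positivity),
      ← ENNReal.ofReal_mul (by positivity), ENNReal.ofReal_le_ofReal_iff (by positivity)] at h3
    have h4 : r ^ n * b ≤ D ^ n * exp s := by
      refine h3.trans (le_of_eq ?_)
      rw [hD, mul_pow (64 * exp 72)]; ring
    have h5 := log_le_log (by positivity) h4
    rw [log_mul (by positivity) hbpos.ne', log_mul (by positivity) (exp_pos _).ne', log_exp,
      log_pow, log_pow] at h5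
    rw [← log_le_log_iff (by positivity) (by positivity), log_mul (by positivity) (exp_pos _).ne',
      log_mul (by positivity) (exp_pos _).ne', log_exp, log_exp, log_pow, log_pow]
    push_cast
    have e1 : 2 * log r + 2 * log b / n = 2 / n * (n * log r + log b) := by field_simp
    have e2 : 2 * log D + 2 * s / n = 2 / n * (n * log D + s) := by field_simp
    rw [e1, e2]
    gcongr
  have H1 := hr r1 _ _ hr1 hvol1 hv1
  have H2 := hr r2 _ _ hr2 hvol2 hv2
  have hG2 : shannonEntropy n h ≤ 80 * n + n * log ρ + log b := by
    have h5 := log_le_log hkpos hk'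
    rw [log_mul (exp_pos _).ne' (by positivity), log_mul (by positivity) hbpos.ne', log_exp,
      log_pow] at h5
    linarith
  unfold entropyPower
  calc exp (2 * shannonEntropy n h / n) ≤ exp (160 + 2 * log ρ + 2 * log b / n) := by
        apply exp_le_exp.2
        have e : 160 + 2 * log ρ + 2 * log b / n = 2 / n * (80 * n + n * log ρ + log b) := by
          field_simp; ring
        rw [e, mul_div_right_comm]
        gcongr
    _ = exp 160 * ρ ^ 2 * exp (2 * log b / n) := by
        rw [exp_add, exp_add]
        congr 2
        have : (2 : ℝ) * log ρ = log (ρ ^ 2) := by rw [log_pow]; norm_num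
        rw [this, exp_log (by positivity)]
    _ = exp 160 * 2 * (r1 ^ 2 * exp (2 * log b / n) + r2 ^ 2 * exp (2 * log b / n)) := by
        rw [hρ2]; ring
    _ ≤ exp 160 * 2 * (D ^ 2 * exp (2 * shannonEntropy n f / n) +
          D ^ 2 * exp (2 * shannonEntropy n g / n)) := by gcongr
    _ = _ := by ring

end REPI

/-- Positional reverse entropy power inequality for log-concave measures
(Bobkov–Madiman): there is a universal constant `C > 0` such that for every
dimension `d` and every pair of independent random vectors `X, Y` in `ℝ^d` with
log-concave densities, there exist linear maps `u₁, u₂ : ℝ^d → ℝ^d` of determinant `1`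
with `N(u₁(X) + u₂(Y)) ≤ C (N(X) + N(Y))`. -/
theorem positional_reverse_epi_logconcave :
    ∃ C : ℝ, 0 < C ∧
      ∀ (d : ℕ), 0 < d →
      ∀ (Ω : Type) (_ : MeasurableSpace Ω) (P : Measure Ω), IsProbabilityMeasure P →
      ∀ (X Y : Ω → (Fin d → ℝ)) (f g : (Fin d → ℝ) → ℝ),
        HasDensityFn P X f → HasDensityFn P Y g →
        IsLogConcaveFn f → IsLogConcaveFn g →
        IndepFun X Y P →
        ∃ u₁ u₂ : (Fin d → ℝ) →ₗ[ℝ] (Fin d → ℝ),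
          LinearMap.det u₁ = 1 ∧ LinearMap.det u₂ = 1 ∧
          ∀ h : (Fin d → ℝ) → ℝ,
            HasDensityFn P (fun ω => u₁ (X ω) + u₂ (Y ω)) h →
            entropyPower d h ≤ C * (entropyPower d f + entropyPower d g) := by
  refine ⟨exp 160 * 2 * ((64 * exp 72) * (8 * exp 2)) ^ 2, by positivity, ?_⟩
  intro d hd Ω _ P _ X Y f g hX hY hf hg hXY
  exact REPI.final hd hX hY hf hg hXY
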